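/- arXiv:1808.03622 — 4 statements merged into one kernel-verified Lean document; each statement's English description precedes it below -/
import Mathlib

section
/- Let g be a unimodal map and let ψ : [0,1] → [0,1] be a non-constant continuous piecewise linear map such that ψ ∘ g = g ∘ ψ. Then ψ(0) = 0. -/
open Set

/-- The tent map `x ↦ 1 - |1 - 2x|`. -/
noncomputable def tent (x : ℝ) : ℝ := 1 - |1 - 2*x|

/-- `g` is unimodal with turning point `v`. -/
def IsUnimodalWith (g : ℝ → ℝ) (v : ℝ) : Prop :=
  ContinuousOn g (Icc 0 1) ∧ MapsTo g (Icc 0 1) (Icc 0 1) ∧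
  v ∈ Ioo (0:ℝ) 1 ∧ StrictMonoOn g (Icc 0 v) ∧ StrictAntiOn g (Icc v 1) ∧
  g 0 = 0 ∧ g 1 = 0 ∧ g v = 1

/-- `g` is unimodal. -/
def IsUnimodal (g : ℝ → ℝ) : Prop := ∃ v, IsUnimodalWith g v

/-- `φ` is piecewise linear on `[0,1]`. -/
def IsPiecewiseLinear (φ : ℝ → ℝ) : Prop :=
  ∃ (m : ℕ) (a : ℕ → ℝ), 0 < m ∧ a 0 = 0 ∧ a m = 1 ∧
    (∀ i < m, a i < a (i+1)) ∧
    ∀ i < m, ∃ c d : ℝ, ∀ x ∈ Icc (a i) (a (i+1)), φ x = c * x + d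
/-- `φ` is affine on `[s,e]`. -/
def LinOnIcc (φ : ℝ → ℝ) (s e : ℝ) : Prop := ∃ c d : ℝ, ∀ x ∈ Icc s e, φ x = c * x + d

/-- `a` is the first (smallest) positive kink of `φ`:
`φ` is linear on `[0,a]` and on no larger interval `[0,c]`. -/
def FirstKink (φ : ℝ → ℝ) (a : ℝ) : Prop :=
  0 < a ∧ LinOnIcc φ 0 a ∧ ∀ c, a < c → ¬ LinOnIcc φ 0 c

/-- The complete preimage of `0` under `g` (inside `[0,1]`). -/
def preimZero (g : ℝ → ℝ) : Set ℝ :=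
  {x | x ∈ Icc (0:ℝ) 1 ∧ ∃ n : ℕ, 1 ≤ n ∧ g^[n] x = 0}

/-- The map `ξ_t`. -/
noncomputable def xi (t : ℕ) (x : ℝ) : ℝ :=
  (1 - (-1:ℝ) ^ ⌊(t:ℝ) * x⌋) / 2 + (-1:ℝ) ^ ⌊(t:ℝ) * x⌋ * Int.fract ((t:ℝ) * x)

/-- `μ n k` enumerates, in increasing order, the `2^(n-1)+1` points of `g^{-n}(0)`. -/
def IsMuFamily (g : ℝ → ℝ) (μ : ℕ → ℕ → ℝ) : Prop :=
  ∀ n : ℕ, 1 ≤ n →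
    (∀ k ≤ 2^(n-1), μ n k ∈ Icc (0:ℝ) 1 ∧ g^[n] (μ n k) = 0) ∧
    (∀ k < 2^(n-1), μ n k < μ n (k+1)) ∧
    (∀ x ∈ Icc (0:ℝ) 1, g^[n] x = 0 → ∃ k ≤ 2^(n-1), x = μ n k)

/-- `ψ` is monotone (in either direction) on `s`. -/
def MonoOrAntiOn (ψ : ℝ → ℝ) (s : Set ℝ) : Prop := MonotoneOn ψ s ∨ AntitoneOn ψ s

/-- `[c,d]` is a maximal interval of monotonicity of `ψ` in `[0,1]`. -/
def IsMaxMonoInterval (ψ : ℝ → ℝ) (c d : ℝ) : Prop :=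
  0 ≤ c ∧ c < d ∧ d ≤ 1 ∧ MonoOrAntiOn ψ (Icc c d) ∧
  ∀ c' d', 0 ≤ c' → d' ≤ 1 → Icc c d ⊆ Icc c' d' → Icc c d ≠ Icc c' d' →
    ¬ MonoOrAntiOn ψ (Icc c' d')

/-- `ψ` has exactly `N` maximal intervals of monotonicity, cut at points `b 0 < ⋯ < b N`. -/
def HasExactlyMonoIntervals (ψ : ℝ → ℝ) (N : ℕ) : Prop :=
  ∃ b : ℕ → ℝ, b 0 = 0 ∧ b N = 1 ∧ (∀ i < N, b i < b (i+1)) ∧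
    (∀ i < N, MonoOrAntiOn ψ (Icc (b i) (b (i+1)))) ∧
    (∀ i, i + 2 ≤ N → ¬ MonoOrAntiOn ψ (Icc (b i) (b (i+2))))
/-- A map attaining a maximum at an interior point of an interval is not injective there. -/
lemma not_injOn_Icc_of_interior_max {h : ℝ → ℝ} {a b x : ℝ} (hc : ContinuousOn h (Icc a b))
    (hx : x ∈ Ioo a b) (hmax : ∀ y ∈ Icc a b, h y ≤ h x) : ¬ InjOn h (Icc a b) := by
  intro hinj
  have hxI : x ∈ Icc a b := Ioo_subset_Icc_self hx
  have haI : a ∈ Icc a b := ⟨le_rfl, (hx.1.trans hx.2).le⟩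
  have hbI : b ∈ Icc a b := ⟨(hx.1.trans hx.2).le, le_rfl⟩
  rcases le_total (h a) (h b) with hab | hab
  · obtain ⟨y, hy, hyb⟩ := intermediate_value_Icc hx.1.le
      (hc.mono (Icc_subset_Icc_right hx.2.le)) ⟨hab, hmax b hbI⟩
    have := hinj ⟨hy.1, hy.2.trans hx.2.le⟩ hbI hyb
    linarith [hy.2, hx.2]
  · obtain ⟨y, hy, hya⟩ := intermediate_value_Icc' hx.2.le
      (hc.mono (Icc_subset_Icc_left hx.1.le)) ⟨hab, hmax a haI⟩
    have := hinj ⟨hx.1.le.trans hy.1, hy.2⟩ haI hya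
    linarith [hy.1, hx.1]

/-- Composing with a unimodal map preserves local injectivity away from the turning point. -/
lemma IsUnimodalWith.exists_injOn_comp {g f : ℝ → ℝ} {v x : ℝ} (hg : IsUnimodalWith g v)
    (hf : ContinuousAt f x) (hf01 : ∀ᶠ y in nhds x, f y ∈ Icc (0 : ℝ) 1)
    (hinj : ∃ U ∈ nhds x, InjOn f U) (hv : f x ≠ v) :
    ∃ U ∈ nhds x, InjOn (fun y => g (f y)) U := by
  obtain ⟨-, -, -, hmono, hanti, -⟩ := hg
  obtain ⟨U, hU, hUinj⟩ := hinj
  rcases lt_or_gt_of_ne hv with h | h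
  · refine ⟨_, Filter.inter_mem hU
      (Filter.inter_mem hf01 (hf.eventually_lt continuousAt_const h)), ?_⟩
    intro y hy z hz hyz
    exact hUinj hy.1 hz.1 (hmono.injOn ⟨hy.2.1.1, le_of_lt hy.2.2⟩ ⟨hz.2.1.1, le_of_lt hz.2.2⟩ hyz)
  · refine ⟨_, Filter.inter_mem hU
      (Filter.inter_mem hf01 (continuousAt_const.eventually_lt hf h)), ?_⟩
    intro y hy z hz hyz
    exact hUinj hy.1 hz.1 (hanti.injOn ⟨le_of_lt hy.2.2, hy.2.1.2⟩ ⟨le_of_lt hz.2.2, hz.2.1.2⟩ hyz)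

lemma IsUnimodalWith.exists_injOn_iterate_comp {g f : ℝ → ℝ} {v x : ℝ}
    (hg : IsUnimodalWith g v)
    (hf : ContinuousAt f x) (hf01 : ∀ᶠ y in nhds x, f y ∈ Icc (0 : ℝ) 1)
    (hinj : ∃ U ∈ nhds x, InjOn f U) (n : ℕ) (hv : ∀ k < n, g^[k] (f x) ≠ v) :
    ∃ U ∈ nhds x, InjOn (fun y => g^[n] (f y)) U := by
  have hgi (k : ℕ) : ContinuousOn g^[k] (Icc 0 1) := hg.1.iterate hg.2.1 k
  induction n with
  | zero => simpa using hinj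
  | succ n ih =>
    simp only [Function.iterate_succ_apply']
    refine hg.exists_injOn_comp ?_ ?_ (ih fun k hk => hv k (by omega)) (hv n (by omega))
    · have hwithin : Filter.Tendsto f (nhds x) (nhdsWithin (f x) (Icc 0 1)) :=
        tendsto_nhdsWithin_iff.2 ⟨hf, hf01⟩
      exact Filter.Tendsto.comp (hgi n (f x) hf01.self_of_nhds) hwithin
    · filter_upwards [hf01] with y hy using hg.2.1.iterate n hy

lemma IsUnimodalWith.surjOn_left {g : ℝ → ℝ} {v : ℝ} (hg : IsUnimodalWith g v) {y : ℝ}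
    (hy : y ∈ Icc (0 : ℝ) 1) : ∃ x ∈ Icc 0 v, g x = y := by
  obtain ⟨hc, -, hv, -, -, h0, -, h1⟩ := hg
  have := intermediate_value_Icc hv.1.le (hc.mono (Icc_subset_Icc_right hv.2.le))
  rw [h0, h1] at this
  exact this hy

lemma iterate_comm_on {g ψ : ℝ → ℝ} (hgm : MapsTo g (Icc 0 1) (Icc 0 1))
    (hcomm : ∀ x ∈ Icc (0:ℝ) 1, ψ (g x) = g (ψ x)) (n : ℕ) {x : ℝ} (hx : x ∈ Icc (0 : ℝ) 1) :
    ψ (g^[n] x) = g^[n] (ψ x) := by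
  induction n with
  | zero => rfl
  | succ n ih =>
    rw [Function.iterate_succ_apply', Function.iterate_succ_apply', hcomm _ (hgm.iterate n hx), ih]

/-- If `ψ` is injective near a preimage of the turning point, then `ψ` fixes `0`. -/
lemma IsUnimodalWith.commutator_zero_of_injOn {g ψ : ℝ → ℝ} {v x : ℝ} (hg : IsUnimodalWith g v)
    (hψc : ContinuousOn ψ (Icc 0 1)) (hψm : MapsTo ψ (Icc 0 1) (Icc 0 1))
    (hcomm : ∀ x ∈ Icc (0:ℝ) 1, ψ (g x) = g (ψ x)) (hx : x ∈ Ioo (0 : ℝ) 1)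
    (hinj : ∃ U ∈ nhds x, InjOn ψ U) {n : ℕ} (hn : g^[n] x = v) : ψ 0 = 0 := by
  have hx01 : Icc (0 : ℝ) 1 ∈ nhds x := Icc_mem_nhds hx.1 hx.2
  have hxI : x ∈ Icc (0 : ℝ) 1 := Ioo_subset_Icc_self hx
  obtain ⟨hc, hm, -, -, -, h0, h1, hv1⟩ := id hg
  by_cases hk : ∀ k < n + 1, g^[k] (ψ x) ≠ v
  · exfalso
    obtain ⟨U, hU, hUinj⟩ := hg.exists_injOn_iterate_comp (hψc.continuousAt hx01)
      (Filter.mem_of_superset hx01 hψm) hinj (n + 1) hk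
    obtain ⟨δ, hδ, hball⟩ := Metric.nhds_basis_closedBall.mem_iff.1 (Filter.inter_mem hU hx01)
    rw [Real.closedBall_eq_Icc] at hball
    have hmax : ∀ y ∈ Icc (x - δ) (x + δ), g^[n + 1] y ≤ g^[n + 1] x := by
      intro y hy
      have : g^[n + 1] x = 1 := by rw [Function.iterate_succ_apply', hn, hv1]
      rw [this]
      exact (hm.iterate (n + 1) (hball hy).2).2
    refine not_injOn_Icc_of_interior_max
      ((hc.iterate hm (n + 1)).mono fun y hy => (hball hy).2)
      ⟨by linarith, by linarith⟩ hmax ?_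
    intro y hy z hz hyz
    refine hUinj (hball hy).1 (hball hz).1 ?_
    change g^[n + 1] (ψ y) = g^[n + 1] (ψ z)
    rw [← iterate_comm_on hm hcomm _ (hball hy).2, ← iterate_comm_on hm hcomm _ (hball hz).2, hyz]
  · push Not at hk
    obtain ⟨k, hkn, hkv⟩ := hk
    have hzero (j : ℕ) : g^[j] 0 = 0 := Function.iterate_fixed h0 j
    have hleft : g^[n + 2] x = 0 := by
      rw [Function.iterate_succ_apply', Function.iterate_succ_apply', hn, hv1, h1]
    have hright : g^[n + 2] (ψ x) = 0 := by
      obtain ⟨j, rfl⟩ : ∃ j, n = j + k := ⟨n - k, by omega⟩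
      rw [show j + k + 2 = j + (2 + k) by omega, Function.iterate_add_apply,
        Function.iterate_add_apply, hkv]
      simp [hv1, h1, hzero]
    rw [← hleft, iterate_comm_on hm hcomm _ hxI, hright, hleft]

/-- The iterated preimages of the turning point under the left branch decrease to a fixed point. -/
lemma IsUnimodalWith.exists_left_preimages {g : ℝ → ℝ} {v : ℝ} (hg : IsUnimodalWith g v) :
    ∃ (u : ℕ → ℝ) (q : ℝ), u 0 = v ∧ (∀ n, u n ∈ Icc 0 v) ∧ (∀ n, g (u (n + 1)) = u n) ∧
      0 ≤ q ∧ g q = q ∧ (∀ n, q < u n) ∧ Filter.Tendsto u Filter.atTop (nhds q) := by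
  obtain ⟨hc, -, hv, hmono, -, -, -, hv1⟩ := id hg
  have hsub {y : ℝ} (hy : y ∈ Icc 0 v) : y ∈ Icc (0 : ℝ) 1 := ⟨hy.1, hy.2.trans hv.2.le⟩
  choose! r hr hgr using fun y (hy : y ∈ Icc (0 : ℝ) 1) => hg.surjOn_left hy
  let u : ℕ → ℝ := fun n => r^[n] v
  have hus (n : ℕ) : u (n + 1) = r (u n) := Function.iterate_succ_apply' r n v
  have hu (n : ℕ) : u n ∈ Icc 0 v := by
    induction n with
    | zero => exact ⟨hv.1.le, le_rfl⟩
    | succ n ih => rw [hus]; exact hr _ (hsub ih)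
  have hgu (n : ℕ) : g (u (n + 1)) = u n := by rw [hus]; exact hgr _ (hsub (hu n))
  have hlt (n : ℕ) : u (n + 1) < u n := by
    rw [← hmono.lt_iff_lt (hu _) (hu _), hgu]
    induction n with
    | zero => change v < g v; rw [hv1]; exact hv.2
    | succ n ih => rw [hgu, ← hmono.lt_iff_lt (hu _) (hu _), hgu]; exact ih
  have hanti : StrictAnti u := strictAnti_nat_of_succ_lt hlt
  have hbdd : BddBelow (range u) := ⟨0, by rintro _ ⟨n, rfl⟩; exact (hu n).1⟩
  have hlim := tendsto_atTop_ciInf hanti.antitone hbdd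
  set q := ⨅ n, u n
  have hqle (n : ℕ) : q ≤ u n := ciInf_le hbdd n
  have hq0 : 0 ≤ q := le_ciInf fun n => (hu n).1
  refine ⟨u, q, rfl, hu, hgu, hq0, ?_, fun n => (hqle (n + 1)).trans_lt (hlt n), hlim⟩
  have hq : q ∈ Icc (0 : ℝ) 1 := hsub ⟨hq0, hqle 0⟩
  have hg_lim : Filter.Tendsto (fun n => g (u (n + 1))) Filter.atTop (nhds (g q)) :=
    Filter.Tendsto.comp (hc q hq) (tendsto_nhdsWithin_iff.2
      ⟨hlim.comp (Filter.tendsto_add_atTop_nat 1), .of_forall fun n => hsub (hu _)⟩)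
  simp only [hgu] at hg_lim
  exact tendsto_nhds_unique hg_lim hlim

lemma IsPiecewiseLinear.exists_linOnIcc_right {φ : ℝ → ℝ} (hφ : IsPiecewiseLinear φ) {q : ℝ}
    (hq0 : 0 ≤ q) (hq1 : q < 1) : ∃ e, q < e ∧ LinOnIcc φ q e := by
  classical
  obtain ⟨m, a, -, ha0, ham, -, hlin⟩ := hφ
  have hex : ∃ j, q < a j := ⟨m, by rwa [ham]⟩
  obtain ⟨i, hi⟩ : ∃ i, Nat.find hex = i + 1 := by
    refine Nat.exists_eq_succ_of_ne_zero fun h => ?_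
    have := Nat.find_spec hex
    rw [h, ha0] at this
    linarith
  have hqi : a i ≤ q := not_lt.1 (Nat.find_min hex (by omega))
  have hqe : q < a (i + 1) := hi ▸ Nat.find_spec hex
  have him : i + 1 ≤ m := hi ▸ Nat.find_min' hex (by rwa [ham])
  obtain ⟨c, d, h⟩ := hlin i (by omega)
  exact ⟨_, hqe, c, d, fun x hx => h x ⟨hqi.trans hx.1, hx.2⟩⟩

/-- If `g` maps `S` over `T`, a commutator that is constant on `S` with value fixed by `g`
takes the same constant value on `T`. -/
lemma commutator_const_of_surjOn {g ψ : ℝ → ℝ} {S T : Set ℝ} {c : ℝ} (hS : S ⊆ Icc 0 1)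
    (hcomm : ∀ x ∈ Icc (0:ℝ) 1, ψ (g x) = g (ψ x)) (hST : SurjOn g S T) (hc : g c = c)
    (hψ : ∀ x ∈ S, ψ x = c) : ∀ x ∈ T, ψ x = c := by
  intro y hy
  obtain ⟨x, hx, rfl⟩ := hST hy
  rw [hcomm x (hS hx), hψ x hx, hc]

/-- a non-constant continuous piecewise linear commutator `ψ` of a
unimodal map satisfies `ψ 0 = 0`. -/
theorem commutator_zero_eq_zero
    (g ψ : ℝ → ℝ) (hg : IsUnimodal g)
    (hψc : ContinuousOn ψ (Icc 0 1)) (hψm : MapsTo ψ (Icc 0 1) (Icc 0 1))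
    (hψPL : IsPiecewiseLinear ψ)
    (hnonconst : ¬ ∃ c : ℝ, ∀ x ∈ Icc (0:ℝ) 1, ψ x = c)
    (hcomm : ∀ x ∈ Icc (0:ℝ) 1, ψ (g x) = g (ψ x)) :
    ψ 0 = 0 := by
  obtain ⟨v, hg⟩ := hg
  obtain ⟨hc, hm, hv, -, -, -, h1, hv1⟩ := id hg
  obtain ⟨u, q, hu0, hu, hgu, hq0, hgq, hqu, hlim⟩ := hg.exists_left_preimages
  have hu1 (n : ℕ) : u n < 1 := (hu n).2.trans_lt hv.2
  have hq1 : q < 1 := (hqu 0).trans (hu1 0)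
  have hqI : q ∈ Icc (0 : ℝ) 1 := ⟨hq0, hq1.le⟩
  obtain ⟨e, hqe, s, d, hlin⟩ := hψPL.exists_linOnIcc_right hq0 hq1
  obtain ⟨n, hn⟩ := (hlim.eventually_lt_const hqe).exists
  have hiter : g^[n] (u n) = v := by
    clear hn
    induction n with
    | zero => exact hu0
    | succ n ih => rw [Function.iterate_succ_apply, hgu, ih]
  by_cases hs : s = 0
  · refine absurd ⟨ψ q, ?_⟩ hnonconst
    have hfix : g (ψ q) = ψ q := by rw [← hcomm q hqI, hgq]
    have hsub {b : ℝ} (hb : b ≤ 1) : Icc q b ⊆ Icc 0 1 := Icc_subset_Icc hq0 hb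
    have hcov {b : ℝ} (hqb : q ≤ b) (hb : b ≤ 1) : SurjOn g (Icc q b) (Icc q (g b)) := by
      have := intermediate_value_Icc hqb (hc.mono (hsub hb))
      rwa [hgq] at this
    have hbase : ∀ x ∈ Icc q (u n), ψ x = ψ q := by
      intro x hx
      rw [hlin x ⟨hx.1, hx.2.trans hn.le⟩, hlin q ⟨le_rfl, hqe.le⟩, hs]
      ring
    have hqv : ∀ x ∈ Icc q v, ψ x = ψ q := by
      clear hn hiter
      induction n with
      | zero => rwa [hu0] at hbase
      | succ n ih =>
        have := commutator_const_of_surjOn (hsub (hu1 _).le) hcomm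
          (hcov (hqu _).le (hu1 (n + 1)).le) hfix hbase
        rw [hgu] at this
        exact ih this
    have hq_one := commutator_const_of_surjOn (hsub hv.2.le) hcomm
      (hcov (hu0 ▸ (hqu 0).le) hv.2.le) hfix hqv
    rw [hv1] at hq_one
    have hright : SurjOn g (Icc v 1) (Icc 0 1) := by
      have := intermediate_value_Icc' hv.2.le (hc.mono (Icc_subset_Icc_left hv.1.le))
      rwa [h1, hv1] at this
    exact commutator_const_of_surjOn (Icc_subset_Icc_left hv.1.le) hcomm hright hfix
      fun x hx => hq_one x ⟨(hu0 ▸ (hqu 0).le : q ≤ v).trans hx.1, hx.2⟩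
  · refine hg.commutator_zero_of_injOn hψc hψm hcomm
      ⟨hq0.trans_lt (hqu n), hu1 n⟩ ⟨Icc q e, Icc_mem_nhds (hqu n) hn, ?_⟩ hiter
    intro y hy z hz hyz
    rw [hlin y hy, hlin z hz] at hyz
    exact mul_left_cancel₀ hs (add_right_cancel hyz)
end

section
/- Let g be a unimodal map and let ψ : [0,1] → [0,1] be a non-constant continuous surjective piecewise linear map such that ψ ∘ g = g ∘ ψ. Then for every maximal interval of monotonicity I of ψ one has ψ(I) = [0,1]; in particular, on each such interval the values of ψ at the two endpoints are 0 and 1 in some order. -/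
open Set

open Filter Topology

theorem map_nhds_of_injOn_Icc {f : ℝ → ℝ} {p q y : ℝ} (hf : ContinuousOn f (Icc p q))
    (hinj : InjOn f (Icc p q)) (hy : y ∈ Ioo p q) : map f (𝓝 y) = 𝓝 (f y) := by
  apply le_antisymm
  · exact hf.continuousAt (Icc_mem_nhds hy.1 hy.2)
  intro U hU
  have hV : f ⁻¹' U ∩ Ioo p q ∈ 𝓝 y := inter_mem hU (Ioo_mem_nhds hy.1 hy.2)
  obtain ⟨⟨a, b⟩, ⟨hay', hyb'⟩, hsub⟩ := (nhds_basis_Ioo' ⟨p, hy.1⟩ ⟨q, hy.2⟩).mem_iff.1 hV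
  obtain ⟨a', ha, ha'⟩ := exists_between hay'
  obtain ⟨b', hb', hb⟩ := exists_between hyb'
  have hI : Icc a' b' ⊆ f ⁻¹' U ∩ Ioo p q :=
    fun z hz => hsub ⟨ha.trans_le hz.1, hz.2.trans_lt hb⟩
  have hIpq : Icc a' b' ⊆ Icc p q := fun z hz => Ioo_subset_Icc_self (hI hz).2
  have hle : a' ≤ b' := (ha'.trans hb').le
  have himg : f '' Icc a' b' ⊆ U := by
    rintro _ ⟨z, hz, rfl⟩
    exact (hI hz).1
  have hay : a' ∈ Icc a' b' := ⟨le_rfl, hle⟩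
  have hby : b' ∈ Icc a' b' := ⟨hle, le_rfl⟩
  have hyy : y ∈ Icc a' b' := ⟨ha'.le, hb'.le⟩
  rcases (hf.mono hIpq).strictMonoOn_of_injOn_Icc' hle (hinj.mono hIpq) with h | h
  · exact mem_of_superset (Icc_mem_nhds (h hay hyy ha') (h hyy hby hb'))
      ((intermediate_value_Icc hle (hf.mono hIpq)).trans himg)
  · exact mem_of_superset (Icc_mem_nhds (h hyy hby hb') (h hay hyy ha'))
      ((intermediate_value_Icc' hle (hf.mono hIpq)).trans himg)

namespace IsUnimodalWith

variable {g : ℝ → ℝ} {v : ℝ}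

theorem continuousOn_left (hg : IsUnimodalWith g v) : ContinuousOn g (Icc 0 v) :=
  hg.1.mono (Icc_subset_Icc_right hg.2.2.1.2.le)

theorem continuousOn_right (hg : IsUnimodalWith g v) : ContinuousOn g (Icc v 1) :=
  hg.1.mono (Icc_subset_Icc_left hg.2.2.1.1.le)

theorem map_nhds (hg : IsUnimodalWith g v) {y : ℝ} (hy : y ∈ Ioo (0 : ℝ) 1) (hyv : y ≠ v) :
    map g (𝓝 y) = 𝓝 (g y) := by
  rcases lt_or_gt_of_ne hyv with h | h
  · exact map_nhds_of_injOn_Icc hg.continuousOn_left hg.2.2.2.1.injOn ⟨hy.1, h⟩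
  · exact map_nhds_of_injOn_Icc hg.continuousOn_right hg.2.2.2.2.1.injOn ⟨h, hy.2⟩

theorem exists_preimage_left (hg : IsUnimodalWith g v) {x : ℝ} (hx : x ∈ Ioo (0 : ℝ) 1) :
    ∃ y ∈ Ioo 0 v, g y = x := by
  have h := intermediate_value_Ioo hg.2.2.1.1.le hg.continuousOn_left
  rw [hg.2.2.2.2.2.1, hg.2.2.2.2.2.2.2] at h
  exact h hx

theorem exists_preimage_right (hg : IsUnimodalWith g v) {x : ℝ} (hx : x ∈ Ioo (0 : ℝ) 1) :
    ∃ y ∈ Ioo v 1, g y = x := by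
  have h := intermediate_value_Ioo' hg.2.2.1.2.le hg.continuousOn_right
  rw [hg.2.2.2.2.2.2.1, hg.2.2.2.2.2.2.2] at h
  exact h hx

/-- A finite subset of `(0,1)` that is closed under taking `g`-preimages is empty. -/
theorem eq_empty_of_preimage_subset (hg : IsUnimodalWith g v) {S : Set ℝ} (hfin : S.Finite)
    (hS : S ⊆ Ioo 0 1) (hpre : ∀ y ∈ Ioo (0 : ℝ) 1, y ≠ v → g y ∈ S → y ∈ S) : S = ∅ := by
  obtain ⟨hv0, hv1⟩ := hg.2.2.1
  have himg : S ⊆ g '' (S ∩ Iio v) := by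
    intro x hx
    obtain ⟨y, hy, rfl⟩ := hg.exists_preimage_left (hS hx)
    exact ⟨y, ⟨hpre y ⟨hy.1, hy.2.trans hv1⟩ hy.2.ne hx, hy.2⟩, rfl⟩
  have hfin' : (S ∩ Iio v).Finite := hfin.subset inter_subset_left
  have hcard : S.ncard ≤ (S ∩ Iio v).ncard :=
    (ncard_le_ncard himg (hfin'.image g)).trans (ncard_image_le hfin')
  have heq : S ∩ Iio v = S := eq_of_subset_of_ncard_le inter_subset_left hcard hfin
  by_contra hne
  obtain ⟨x, hx⟩ := nonempty_iff_ne_empty.2 hne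
  obtain ⟨y, hy, rfl⟩ := hg.exists_preimage_right (hS hx)
  have hyS := hpre y ⟨hv0.trans hy.1, hy.2⟩ hy.1.ne' hx
  rw [← heq] at hyS
  exact lt_asymm hy.1 hyS.2

theorem eventually_injective (hg : IsUnimodalWith g v) {p : ℝ} (hpv : p ≠ v) :
    ∀ᶠ w in 𝓝 p ×ˢ 𝓝 p, w.1 ∈ Icc (0 : ℝ) 1 → w.2 ∈ Icc (0 : ℝ) 1 →
      g w.1 = g w.2 → w.1 = w.2 := by
  rcases lt_or_gt_of_ne hpv with h | h
  · filter_upwards [prod_mem_prod (Iio_mem_nhds h) (Iio_mem_nhds h)] with w hw h1 h2 heq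
    exact hg.2.2.2.1.injOn ⟨h1.1, le_of_lt hw.1⟩ ⟨h2.1, le_of_lt hw.2⟩ heq
  · filter_upwards [prod_mem_prod (Ioi_mem_nhds h) (Ioi_mem_nhds h)] with w hw h1 h2 heq
    exact hg.2.2.2.2.1.injOn ⟨le_of_lt hw.1, h1.2⟩ ⟨le_of_lt hw.2, h2.2⟩ heq

theorem lt_one (hg : IsUnimodalWith g v) {w : ℝ} (hw : w ∈ Icc (0 : ℝ) 1) (hwv : w ≠ v) :
    g w < 1 := by
  obtain ⟨-, -, ⟨hv0, hv1⟩, hmono, hanti, -, -, hgv⟩ := hg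
  rw [← hgv]
  rcases lt_or_gt_of_ne hwv with h | h
  · exact hmono ⟨hw.1, h.le⟩ ⟨hv0.le, le_rfl⟩ h
  · exact hanti ⟨le_rfl, hv1.le⟩ ⟨h.le, hw.2⟩ h

theorem pos (hg : IsUnimodalWith g v) {w : ℝ} (hw : w ∈ Ioo (0 : ℝ) 1) : 0 < g w := by
  obtain ⟨-, -, ⟨hv0, hv1⟩, hmono, hanti, hg0, hg1, -⟩ := hg
  rcases le_total w v with h | h
  · rw [← hg0]
    exact hmono ⟨le_rfl, hv0.le⟩ ⟨hw.1.le, h⟩ hw.1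
  · rw [← hg1]
    exact hanti ⟨h, hw.2.le⟩ ⟨hv1.le, le_rfl⟩ hw.2

theorem eq_zero_or_one (hg : IsUnimodalWith g v) {w : ℝ} (hw : w ∈ Icc (0 : ℝ) 1)
    (h : g w = 0) : w = 0 ∨ w = 1 := by
  by_contra! hne
  exact (hg.pos ⟨hw.1.lt_of_ne' hne.1, hw.2.lt_of_ne hne.2⟩).ne' h

theorem eventually_eq_of_map_eq (hg : IsUnimodalWith g v) (p : ℝ) :
    ∀ᶠ w in 𝓝 p, w ∈ Icc (0 : ℝ) 1 → p ∈ Icc (0 : ℝ) 1 → g w = g p → w = p := by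
  by_cases hpv : p = v
  · refine Eventually.of_forall fun w hw _ heq => ?_
    by_contra hne
    subst hpv
    exact (hg.lt_one hw hne).ne (heq.trans hg.2.2.2.2.2.2.2)
  · have h := (hg.eventually_injective hpv).curry
    filter_upwards [h] with w hw h1 h2 heq
    exact hw.self_of_nhds h1 h2 heq

theorem exists_fold (hg : IsUnimodalWith g v) {U : Set ℝ} (hU : U ∈ 𝓝 v) :
    ∃ p ∈ U ∩ Icc 0 1, ∃ q ∈ U ∩ Icc 0 1, g p = g q ∧ p ≠ q := by
  have hgl := hg.continuousOn_left
  have hgr := hg.continuousOn_right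
  obtain ⟨-, -, ⟨hv0, hv1⟩, hmono, hanti, -, -, -⟩ := hg
  obtain ⟨⟨a', b'⟩, ⟨ha', hb'⟩, hsub⟩ := (nhds_basis_Ioo' ⟨0, hv0⟩ ⟨1, hv1⟩).mem_iff.1
    (inter_mem hU (Icc_mem_nhds hv0 hv1))
  obtain ⟨a, haa, ha⟩ := exists_between ha'
  obtain ⟨b, hb, hbb⟩ := exists_between hb'
  have hI : Icc a b ⊆ U ∩ Icc 0 1 :=
    fun z hz => hsub ⟨haa.trans_le hz.1, hz.2.trans_lt hbb⟩
  have hab := (ha.trans hb).le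
  have ha0 := (hI ⟨le_rfl, hab⟩).2
  have hb0 := (hI ⟨hab, le_rfl⟩).2
  have hga : g a < g v := hmono ⟨ha0.1, ha.le⟩ ⟨hv0.le, le_rfl⟩ ha
  have hgb : g b < g v := hanti ⟨le_rfl, hv1.le⟩ ⟨hb.le, hb0.2⟩ hb
  rcases le_total (g a) (g b) with h | h
  · obtain ⟨p, hp, hpe⟩ := intermediate_value_Icc ha.le
      (hgl.mono (Icc_subset_Icc_left ha0.1)) ⟨h, hgb.le⟩
    exact ⟨p, hI ⟨hp.1, hp.2.trans hb.le⟩, b, hI ⟨hab, le_rfl⟩, hpe, (hp.2.trans_lt hb).ne⟩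
  · obtain ⟨q, hq, hqe⟩ := intermediate_value_Icc' hb.le
      (hgr.mono (Icc_subset_Icc_right hb0.2)) ⟨h, hga.le⟩
    exact ⟨a, hI ⟨le_rfl, hab⟩, q, hI ⟨ha.le.trans hq.1, hq.2⟩, hqe.symm,
      (ha.trans_le hq.1).ne⟩

end IsUnimodalWith

theorem IsPiecewiseLinear.exists_finite {ψ : ℝ → ℝ} (h : IsPiecewiseLinear ψ) :
    ∃ A : Set ℝ, A.Finite ∧ ∀ x ∈ Ioo (0 : ℝ) 1, x ∉ A →
      ∃ c d : ℝ, ∀ᶠ z in 𝓝 x, ψ z = c * z + d := by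
  obtain ⟨m, a, -, h0, h1, -, hlin⟩ := h
  refine ⟨a '' Iic m, (finite_Iic m).image a, fun x hx hxA => ?_⟩
  have hex : ∃ j, x ≤ a j := ⟨m, h1 ▸ hx.2.le⟩
  classical
  have hfind := Nat.find_spec hex
  have hmin := fun k => Nat.find_min hex (m := k)
  have hjm : Nat.find hex ≤ m := Nat.find_min' hex (h1 ▸ hx.2.le)
  generalize Nat.find hex = j at hfind hmin hjm
  cases j with
  | zero => exact absurd hx.1 (not_lt.2 (h0 ▸ hfind))
  | succ i =>
    obtain ⟨c, d, hcd⟩ := hlin i hjm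
    have hlt : a i < x := not_le.1 (hmin i i.lt_succ_self)
    have hlt' : x < a (i + 1) := hfind.lt_of_ne fun he => hxA ⟨i + 1, hjm, he.symm⟩
    exact ⟨c, d, mem_of_superset (Icc_mem_nhds hlt hlt') hcd⟩

/-- `ψ` is constant near `x`. -/
def ConstNear (ψ : ℝ → ℝ) (x : ℝ) : Prop := ∀ᶠ z in 𝓝 x, ψ z = ψ x

/-- `ψ` is injective near `x`. -/
def InjNear (ψ : ℝ → ℝ) (x : ℝ) : Prop :=
  ∀ᶠ w in 𝓝 x ×ˢ 𝓝 x, ψ w.1 = ψ w.2 → w.1 = w.2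

theorem ConstNear.eventually {ψ : ℝ → ℝ} {x : ℝ} (h : ConstNear ψ x) :
    ∀ᶠ z in 𝓝 x, ConstNear ψ z := by
  filter_upwards [h.eventually_nhds, h] with z hz hzx
  filter_upwards [hz] with w hw
  rw [hw, hzx]

theorem constNear_of_affine {ψ : ℝ → ℝ} {x d : ℝ} (h : ∀ᶠ z in 𝓝 x, ψ z = 0 * z + d) :
    ConstNear ψ x := by
  filter_upwards [h] with z hz
  rw [hz, h.self_of_nhds, zero_mul, zero_mul]

theorem injNear_of_affine {ψ : ℝ → ℝ} {x c d : ℝ} (hc : c ≠ 0)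
    (h : ∀ᶠ z in 𝓝 x, ψ z = c * z + d) : InjNear ψ x := by
  filter_upwards [h.prod_mk h] with w hw heq
  rw [hw.1, hw.2] at heq
  exact mul_left_cancel₀ hc (add_right_cancel heq)

theorem not_constNear_of_affine {ψ : ℝ → ℝ} {x c d : ℝ} (hc : c ≠ 0)
    (h : ∀ᶠ z in 𝓝 x, ψ z = c * z + d) : ¬ ConstNear ψ x := by
  intro hC
  have : ∀ᶠ z in 𝓝 x, z = x := by
    filter_upwards [h, hC] with z hz hzx
    rw [hz, h.self_of_nhds] at hzx
    exact mul_left_cancel₀ hc (add_right_cancel hzx)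
  obtain ⟨z, hz, hzx⟩ := ((this.filter_mono nhdsWithin_le_nhds).and
    (self_mem_nhdsWithin (a := x) (s := {x}ᶜ))).exists
  exact hzx hz

theorem InjNear.exists_Icc {ψ : ℝ → ℝ} {x l r : ℝ} (h : InjNear ψ x) (hl : l < x) (hr : x < r) :
    ∃ a b, l ≤ a ∧ a < x ∧ x < b ∧ b ≤ r ∧ InjOn ψ (Icc a b) := by
  obtain ⟨U, hU, hUU⟩ := mem_prod_self_iff.1 h
  obtain ⟨⟨a', b'⟩, ⟨ha', hb'⟩, hsub⟩ := (nhds_basis_Ioo' ⟨l, hl⟩ ⟨r, hr⟩).mem_iff.1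
    (inter_mem hU (Icc_mem_nhds hl hr))
  obtain ⟨a, haa, ha⟩ := exists_between ha'
  obtain ⟨b, hb, hbb⟩ := exists_between hb'
  have hI : Icc a b ⊆ U ∩ Icc l r :=
    fun z hz => hsub ⟨haa.trans_le hz.1, hz.2.trans_lt hbb⟩
  have hab := (ha.trans hb).le
  exact ⟨a, b, (hI ⟨le_rfl, hab⟩).2.1, ha, hb, (hI ⟨hab, le_rfl⟩).2.2,
    fun p hp q hq => @hUU (p, q) ⟨(hI hp).1, (hI hq).1⟩⟩

theorem MonoOrAntiOn.extend_left {ψ : ℝ → ℝ} {a b c d : ℝ} (hab : ContinuousOn ψ (Icc a b))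
    (hinj : InjOn ψ (Icc a b)) (hac : a < c) (hcb : c < b) (hbd : b ≤ d)
    (h : MonoOrAntiOn ψ (Icc c d)) : MonoOrAntiOn ψ (Icc a d) := by
  have hcd := hcb.le.trans hbd
  have hsub : Icc a c ⊆ Icc a b := Icc_subset_Icc_right hcb.le
  have hc : c ∈ Icc a b := ⟨hac.le, hcb.le⟩
  have hb : b ∈ Icc a b := ⟨(hac.trans hcb).le, le_rfl⟩
  have hc' : c ∈ Icc c d := ⟨le_rfl, hcd⟩
  have hb' : b ∈ Icc c d := ⟨hcb.le, hbd⟩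
  rw [← Icc_union_Icc_eq_Icc hac.le hcd]
  rcases hab.strictMonoOn_of_injOn_Icc' (hac.trans hcb).le hinj with h1 | h1 <;>
    rcases h with h2 | h2
  · exact Or.inl ((h1.mono hsub).monotoneOn.union_right h2 (isGreatest_Icc hac.le)
      (isLeast_Icc hcd))
  · exact absurd (h1 hc hb hcb) (h2 hc' hb' hcb.le).not_gt
  · exact absurd (h1 hc hb hcb) (h2 hc' hb' hcb.le).not_gt
  · exact Or.inr ((h1.mono hsub).antitoneOn.union_right h2 (isGreatest_Icc hac.le)
      (isLeast_Icc hcd))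

theorem MonoOrAntiOn.extend_right {ψ : ℝ → ℝ} {a b c d : ℝ} (hab : ContinuousOn ψ (Icc a b))
    (hinj : InjOn ψ (Icc a b)) (hca : c ≤ a) (had : a < d) (hdb : d < b)
    (h : MonoOrAntiOn ψ (Icc c d)) : MonoOrAntiOn ψ (Icc c b) := by
  have hcd := hca.trans had.le
  have hsub : Icc d b ⊆ Icc a b := Icc_subset_Icc_left had.le
  have hd : d ∈ Icc a b := ⟨had.le, hdb.le⟩
  have ha : a ∈ Icc a b := ⟨le_rfl, (had.trans hdb).le⟩
  have hd' : d ∈ Icc c d := ⟨hcd, le_rfl⟩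
  have ha' : a ∈ Icc c d := ⟨hca, had.le⟩
  rw [← Icc_union_Icc_eq_Icc hcd hdb.le]
  rcases hab.strictMonoOn_of_injOn_Icc' (had.trans hdb).le hinj with h1 | h1 <;>
    rcases h with h2 | h2
  · exact Or.inl (h2.union_right (h1.mono hsub).monotoneOn (isGreatest_Icc hcd)
      (isLeast_Icc hdb.le))
  · exact absurd (h1 ha hd had) (h2 ha' hd' had.le).not_gt
  · exact absurd (h1 ha hd had) (h2 ha' hd' had.le).not_gt
  · exact Or.inr (h2.union_right (h1.mono hsub).antitoneOn (isGreatest_Icc hcd)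
      (isLeast_Icc hdb.le))

section Commuting

variable {g ψ : ℝ → ℝ} {v : ℝ}

theorem constNear_apply_iff (hg : IsUnimodalWith g v) (hψc : ContinuousOn ψ (Icc 0 1))
    (hψm : MapsTo ψ (Icc 0 1) (Icc 0 1)) (hcomm : ∀ x ∈ Icc (0 : ℝ) 1, ψ (g x) = g (ψ x))
    {y : ℝ} (hy : y ∈ Ioo (0 : ℝ) 1) (hyv : y ≠ v) :
    ConstNear ψ (g y) ↔ ConstNear ψ y := by
  have hI : ∀ᶠ z in 𝓝 y, z ∈ Icc (0 : ℝ) 1 := Icc_mem_nhds hy.1 hy.2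
  unfold ConstNear
  rw [← hg.map_nhds hy hyv, eventually_map, hcomm y hI.self_of_nhds]
  constructor
  · intro h
    filter_upwards [h, hI, (hψc.continuousAt hI).eventually (hg.eventually_eq_of_map_eq (ψ y))]
      with z hz hzI hzψ
    exact hzψ (hψm hzI) (hψm hI.self_of_nhds) (hcomm z hzI ▸ hz)
  · intro h
    filter_upwards [h, hI] with z hz hzI
    rw [hcomm z hzI, hz]

theorem InjNear.apply (hg : IsUnimodalWith g v) (hψc : ContinuousOn ψ (Icc 0 1))
    (hψm : MapsTo ψ (Icc 0 1) (Icc 0 1)) (hcomm : ∀ x ∈ Icc (0 : ℝ) 1, ψ (g x) = g (ψ x))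
    {y : ℝ} (hy : y ∈ Ioo (0 : ℝ) 1) (hψv : ψ y ≠ v) (h : InjNear ψ y) :
    ∀ᶠ w in 𝓝 y ×ˢ 𝓝 y, ψ (g w.1) = ψ (g w.2) → w.1 = w.2 := by
  have hI : ∀ᶠ z in 𝓝 y, z ∈ Icc (0 : ℝ) 1 := Icc_mem_nhds hy.1 hy.2
  have hψ : Tendsto ψ (𝓝 y) (𝓝 (ψ y)) := hψc.continuousAt hI
  filter_upwards [h, hI.prod_mk hI, (hψ.prodMap hψ).eventually (hg.eventually_injective hψv)]
    with w hw hwI hwψ heq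
  rw [hcomm _ hwI.1, hcomm _ hwI.2] at heq
  exact hw (hwψ (hψm hwI.1) (hψm hwI.2) heq)

theorem not_constNear (hg : IsUnimodalWith g v) (hψc : ContinuousOn ψ (Icc 0 1))
    (hψm : MapsTo ψ (Icc 0 1) (Icc 0 1)) (hPL : IsPiecewiseLinear ψ)
    (hnonconst : ¬ ∃ c0 : ℝ, ∀ x ∈ Icc (0:ℝ) 1, ψ x = c0)
    (hcomm : ∀ x ∈ Icc (0 : ℝ) 1, ψ (g x) = g (ψ x)) {x : ℝ} (hx : x ∈ Ioo (0 : ℝ) 1) :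
    ¬ ConstNear ψ x := by
  obtain ⟨A, hA, hlin⟩ := hPL.exists_finite
  have hdich : ∀ x ∈ Ioo (0 : ℝ) 1, ConstNear ψ x ∨ ∀ᶠ z in 𝓝 x, ¬ ConstNear ψ z := by
    have hempty : {x ∈ Ioo (0 : ℝ) 1 | ¬ ConstNear ψ x ∧ ¬ ∀ᶠ z in 𝓝 x, ¬ ConstNear ψ z} = ∅ := by
      refine hg.eq_empty_of_preimage_subset (hA.subset ?_) (fun x hx => hx.1) ?_
      · rintro x ⟨hx, hC, hD⟩
        by_contra hxA
        obtain ⟨c, d, hcd⟩ := hlin x hx hxA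
        rcases eq_or_ne c 0 with rfl | hc
        · exact hC (constNear_of_affine hcd)
        · exact hD (hcd.eventually_nhds.mono fun z hz => not_constNear_of_affine hc hz)
      · rintro y hy hyv ⟨-, hC, hD⟩
        refine ⟨hy, fun h => hC ((constNear_apply_iff hg hψc hψm hcomm hy hyv).2 h),
          fun h => hD ?_⟩
        rw [← hg.map_nhds hy hyv, eventually_map]
        filter_upwards [h, Ioo_mem_nhds hy.1 hy.2, isOpen_ne.mem_nhds hyv] with z hz hzI hzv
        rwa [constNear_apply_iff hg hψc hψm hcomm hzI hzv]
    intro x hx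
    by_contra! hne
    exact (eq_empty_iff_forall_notMem.1 hempty x) ⟨hx, hne.1, by simpa using hne.2⟩
  intro hC
  have hall : Ioo (0 : ℝ) 1 ⊆ {x | ConstNear ψ x} := by
    refine isPreconnected_Ioo.subset_left_of_subset_union
      (v := {x | ∀ᶠ z in 𝓝 x, ¬ ConstNear ψ z}) ?_ ?_ ?_ hdich ⟨x, hx, hC⟩
    · exact isOpen_iff_mem_nhds.2 fun x hx => ConstNear.eventually hx
    · exact isOpen_iff_mem_nhds.2 fun x hx => Eventually.eventually_nhds hx
    · exact disjoint_left.2 fun x hx hx' => hx'.self_of_nhds hx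
  refine hnonconst ⟨ψ 0, fun z hz => ?_⟩
  rcases hz.1.eq_or_lt with rfl | hz0
  · rfl
  obtain ⟨w, -, hw⟩ := exists_hasDerivAt_eq_slope ψ (fun _ => 0) hz0
    (hψc.mono (Icc_subset_Icc_right hz.2))
    (fun w hw => (hasDerivAt_const w (ψ w)).congr_of_eventuallyEq
      (hall ⟨hw.1, hw.2.trans_le hz.2⟩))
  rw [eq_comm, div_eq_zero_iff] at hw
  rcases hw with hw | hw <;> linarith

theorem injNear_of_ne (hg : IsUnimodalWith g v) (hψc : ContinuousOn ψ (Icc 0 1))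
    (hψm : MapsTo ψ (Icc 0 1) (Icc 0 1)) (hPL : IsPiecewiseLinear ψ)
    (hnonconst : ¬ ∃ c0 : ℝ, ∀ x ∈ Icc (0:ℝ) 1, ψ x = c0)
    (hcomm : ∀ x ∈ Icc (0 : ℝ) 1, ψ (g x) = g (ψ x)) {x : ℝ} (hx : x ∈ Ioo (0 : ℝ) 1)
    (h0 : ψ x ≠ 0) (h1 : ψ x ≠ 1) : InjNear ψ x := by
  obtain ⟨A, hA, hlin⟩ := hPL.exists_finite
  have hempty : {x ∈ Ioo (0 : ℝ) 1 | ¬ InjNear ψ x ∧ ψ x ≠ 0 ∧ ψ x ≠ 1} = ∅ := by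
    refine hg.eq_empty_of_preimage_subset (hA.subset ?_) (fun x hx => hx.1) ?_
    · rintro x ⟨hx, hC, -⟩
      by_contra hxA
      obtain ⟨c, d, hcd⟩ := hlin x hx hxA
      rcases eq_or_ne c 0 with rfl | hc
      · exact not_constNear hg hψc hψm hPL hnonconst hcomm hx (constNear_of_affine hcd)
      · exact hC (injNear_of_affine hc hcd)
    · rintro y hy hyv ⟨-, hL, hy0, hy1⟩
      rw [hcomm y (Ioo_subset_Icc_self hy)] at hy0 hy1
      obtain ⟨-, -, -, -, -, hg0, hg1, hgv⟩ := id hg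
      refine ⟨hy, fun h => hL ?_, fun h => hy0 (by rw [h, hg0]), fun h => hy0 (by rw [h, hg1])⟩
      unfold InjNear
      rw [← hg.map_nhds hy hyv, prod_map_map_eq, eventually_map]
      exact (h.apply hg hψc hψm hcomm hy fun h => hy1 (by rw [h, hgv])).mono
        fun w hw heq => congrArg g (hw heq)
  by_contra hL
  exact (eq_empty_iff_forall_notMem.1 hempty x) ⟨hx, hL, h0, h1⟩

theorem apply_zero_eq_zero (hg : IsUnimodalWith g v) (hψc : ContinuousOn ψ (Icc 0 1))
    (hψm : MapsTo ψ (Icc 0 1) (Icc 0 1)) (hPL : IsPiecewiseLinear ψ)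
    (hnonconst : ¬ ∃ c0 : ℝ, ∀ x ∈ Icc (0:ℝ) 1, ψ x = c0)
    (hcomm : ∀ x ∈ Icc (0 : ℝ) 1, ψ (g x) = g (ψ x)) : ψ 0 = 0 := by
  obtain ⟨-, -, hv, -, -, hg0, hg1, hgv⟩ := id hg
  have hψ1 : ψ 1 = g (ψ v) := by rw [← hcomm v (Ioo_subset_Icc_self hv), hgv]
  have hψ0 : ψ 0 = g (ψ 1) := by rw [← hcomm 1 ⟨zero_le_one, le_rfl⟩, hg1]
  by_cases hψv : ψ v = v
  · rw [hψ0, hψ1, hψv, hgv, hg1]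
  by_cases h0 : ψ v = 0
  · rw [hψ0, hψ1, h0, hg0, hg0]
  by_cases h1 : ψ v = 1
  · rw [hψ0, hψ1, h1, hg1, hg0]
  have hL := (injNear_of_ne hg hψc hψm hPL hnonconst hcomm hv h0 h1).apply hg hψc hψm hcomm hv hψv
  obtain ⟨U, hU, hUU⟩ := mem_prod_self_iff.1 hL
  obtain ⟨p, hp, q, hq, hpq, hne⟩ := hg.exists_fold hU
  exact absurd (@hUU (p, q) ⟨hp.1, hq.1⟩ (congrArg ψ hpq)) hne

end Commuting

/-- every maximal interval of monotonicity of a non-constant continuous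
surjective piecewise linear commutator of a unimodal map is mapped onto `[0,1]`,
and the endpoint values are `0` and `1` in some order. -/
theorem max_mono_interval_onto
    (g ψ : ℝ → ℝ) (c d : ℝ) (hg : IsUnimodal g)
    (hψc : ContinuousOn ψ (Icc 0 1)) (hψm : MapsTo ψ (Icc 0 1) (Icc 0 1))
    (hψs : SurjOn ψ (Icc 0 1) (Icc 0 1))
    (hψPL : IsPiecewiseLinear ψ)
    (hnonconst : ¬ ∃ c0 : ℝ, ∀ x ∈ Icc (0:ℝ) 1, ψ x = c0)
    (hcomm : ∀ x ∈ Icc (0:ℝ) 1, ψ (g x) = g (ψ x))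
    (hI : IsMaxMonoInterval ψ c d) :
    ψ '' (Icc c d) = Icc 0 1 ∧ ((ψ c = 0 ∧ ψ d = 1) ∨ (ψ c = 1 ∧ ψ d = 0)) := by
  obtain ⟨v, hg⟩ := hg
  obtain ⟨hc0, hcd, hd1, hmono, hmax⟩ := hI
  have hψ0 := apply_zero_eq_zero hg hψc hψm hψPL hnonconst hcomm
  have hψ1 : ψ 1 = 0 ∨ ψ 1 = 1 := by
    have h1 : (1 : ℝ) ∈ Icc (0 : ℝ) 1 := ⟨zero_le_one, le_rfl⟩
    refine hg.eq_zero_or_one (hψm h1) ?_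
    rw [← hcomm 1 h1, hg.2.2.2.2.2.2.1, hψ0]
  have hc : ψ c = 0 ∨ ψ c = 1 := by
    rcases hc0.eq_or_lt with rfl | hc0
    · exact Or.inl hψ0
    by_contra! hne
    obtain ⟨a, b, ha, hac, hcb, hb, hinj⟩ := (injNear_of_ne hg hψc hψm hψPL hnonconst hcomm
      ⟨hc0, hcd.trans_le hd1⟩ hne.1 hne.2).exists_Icc hc0 hcd
    refine hmax a d ha hd1 (Icc_subset_Icc_left hac.le) (fun he => ?_)
      (hmono.extend_left (hψc.mono (Icc_subset_Icc ha (hb.trans hd1))) hinj hac hcb hb)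
    exact hac.not_ge (he.symm.subset (left_mem_Icc.2 (hac.trans hcd).le)).1
  have hd : ψ d = 0 ∨ ψ d = 1 := by
    rcases hd1.eq_or_lt with rfl | hd1
    · exact hψ1
    by_contra! hne
    obtain ⟨a, b, ha, had, hdb, hb, hinj⟩ := (injNear_of_ne hg hψc hψm hψPL hnonconst hcomm
      ⟨hc0.trans_lt hcd, hd1⟩ hne.1 hne.2).exists_Icc hcd hd1
    refine hmax c b hc0 hb (Icc_subset_Icc_right hdb.le) (fun he => ?_)
      (hmono.extend_right (hψc.mono (Icc_subset_Icc (hc0.trans ha) hb)) hinj ha had hdb)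
    exact hdb.not_ge (he.symm.subset (right_mem_Icc.2 (hcd.trans hdb).le)).2
  have hne : ψ c ≠ ψ d := by
    intro heq
    have hconst : ∀ z ∈ Icc c d, ψ z = ψ c := by
      intro z hz
      rcases hmono with h | h
      · exact le_antisymm (heq ▸ h hz (right_mem_Icc.2 hcd.le) hz.2)
          (h (left_mem_Icc.2 hcd.le) hz hz.1)
      · exact le_antisymm (h (left_mem_Icc.2 hcd.le) hz hz.1)
          (heq ▸ h hz (right_mem_Icc.2 hcd.le) hz.2)
    obtain ⟨m, hcm, hmd⟩ := exists_between hcd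
    refine not_constNear hg hψc hψm hψPL hnonconst hcomm
      ⟨hc0.trans_lt hcm, hmd.trans_le hd1⟩ ?_
    filter_upwards [Icc_mem_nhds hcm hmd] with z hz
    rw [hconst z hz, hconst m ⟨hcm.le, hmd.le⟩]
  have hends : (ψ c = 0 ∧ ψ d = 1) ∨ (ψ c = 1 ∧ ψ d = 0) := by grind
  refine ⟨Subset.antisymm ?_ ?_, hends⟩
  · exact (hψm.mono_left (Icc_subset_Icc hc0 hd1)).image_subset
  · have hcont := hψc.mono (Icc_subset_Icc hc0 hd1)
    rcases hends with ⟨h1, h2⟩ | ⟨h1, h2⟩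
    · simpa only [h1, h2] using intermediate_value_Icc hcd.le hcont
    · simpa only [h1, h2] using intermediate_value_Icc' hcd.le hcont
end

section
/- Let g be a unimodal map topologically conjugate to the tent map f via a homeomorphism h with h ∘ f = g ∘ h. Then for any self semi conjugation ψ of g there exists t ∈ ℕ, t ≥ 1, such that ψ = h ∘ ξ_t ∘ h^{−1}, where ξ_t(x) = (1 − (−1)^{⌊tx⌋})/2 + (−1)^{⌊tx⌋}·{tx}. -/
open Set

/-- The triangle wave of period two, that is, the distance to the nearest even integer. -/
noncomputable def fold (y : ℝ) : ℝ :=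
  (1 - (-1 : ℝ) ^ ⌊y⌋) / 2 + (-1 : ℝ) ^ ⌊y⌋ * Int.fract y

theorem xi_eq_fold (t : ℕ) (x : ℝ) : xi t x = fold (t * x) := rfl

theorem fold_spec (y : ℝ) : ∃ k : ℤ, fold y = y - 2 * k ∨ fold y = 2 * k - y := by
  rcases Int.even_or_odd ⌊y⌋ with he | ho
  · obtain ⟨k, hk⟩ := id he
    refine ⟨k, Or.inl ?_⟩
    have hk' : (⌊y⌋ : ℝ) = k + k := by exact_mod_cast hk
    rw [fold, he.neg_one_zpow, Int.fract, hk']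
    ring
  · obtain ⟨k, hk⟩ := id ho
    refine ⟨k + 1, Or.inr ?_⟩
    have hk' : (⌊y⌋ : ℝ) = 2 * k + 1 := by exact_mod_cast hk
    rw [fold, ho.neg_one_zpow, Int.fract, hk']
    push_cast
    ring

theorem fold_mem (y : ℝ) : fold y ∈ Icc (0 : ℝ) 1 := by
  have h0 := Int.fract_nonneg y
  have h1 := Int.fract_lt_one y
  rcases Int.even_or_odd ⌊y⌋ with he | ho
  · rw [fold, he.neg_one_zpow]
    constructor <;> linarith
  · rw [fold, ho.neg_one_zpow]
    constructor <;> linarith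

theorem fold_le_abs_sub (y : ℝ) (k : ℤ) : fold y ≤ |y - 2 * k| := by
  obtain ⟨j, hj⟩ := fold_spec y
  obtain ⟨h0, h1⟩ := fold_mem y
  rcases lt_trichotomy j k with h | h | h
  · have : (j : ℝ) + 1 ≤ k := by exact_mod_cast h
    rw [abs_sub_comm]
    refine le_trans ?_ (le_abs_self _)
    rcases hj with hj | hj <;> linarith
  · subst h
    rcases hj with hj | hj
    · exact hj ▸ le_abs_self _
    · rw [abs_sub_comm]
      exact hj ▸ le_abs_self _
  · have : (k : ℝ) + 1 ≤ j := by exact_mod_cast h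
    refine le_trans ?_ (le_abs_self _)
    rcases hj with hj | hj <;> linarith

theorem fold_le_add (x y : ℝ) : fold y ≤ fold x + |x - y| := by
  obtain ⟨k, hk⟩ := fold_spec x
  have h1 : fold x = |x - 2 * k| := by
    have h0 := (fold_mem x).1
    rcases hk with hk | hk
    · rw [hk, abs_of_nonneg (hk ▸ h0)]
    · rw [abs_sub_comm, hk, abs_of_nonneg (hk ▸ h0)]
  calc fold y ≤ |y - 2 * k| := fold_le_abs_sub y k
    _ = |(x - 2 * k) - (x - y)| := by ring_nf
    _ ≤ |x - 2 * k| + |x - y| := abs_sub _ _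
    _ = _ := by rw [h1]

theorem lipschitzWith_fold : LipschitzWith 1 fold :=
  LipschitzWith.of_le_add fun x y => by
    rw [Real.dist_eq, abs_sub_comm]
    exact fold_le_add y x

theorem eq_fold {y z : ℝ} (hz : z ∈ Icc (0 : ℝ) 1) (k : ℤ)
    (h : z = y - 2 * k ∨ z = 2 * k - y) : z = fold y := by
  have hzk : z = |y - 2 * k| := by
    rcases h with h | h
    · rw [← h, abs_of_nonneg hz.1]
    · rw [abs_sub_comm, ← h, abs_of_nonneg hz.1]
  refine le_antisymm ?_ (hzk ▸ fold_le_abs_sub y k)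
  obtain ⟨j, hj⟩ := fold_spec y
  obtain ⟨h0, h1⟩ := fold_mem y
  obtain ⟨z0, z1⟩ := hz
  rcases lt_trichotomy j k with hjk | hjk | hjk
  · have : (j : ℝ) + 1 ≤ k := by exact_mod_cast hjk
    rcases hj with hj | hj <;> rcases h with h | h <;> linarith
  · subst hjk
    rcases hj with hj | hj <;> rcases h with h | h <;> linarith
  · have : (k : ℝ) + 1 ≤ j := by exact_mod_cast hjk
    rcases hj with hj | hj <;> rcases h with h | h <;> linarith

theorem fold_of_mem {z : ℝ} (hz : z ∈ Icc (0 : ℝ) 1) : fold z = z :=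
  (eq_fold hz 0 (Or.inl (by simp))).symm

theorem fold_neg (y : ℝ) : fold (-y) = fold y := by
  obtain ⟨k, hk⟩ := fold_spec (-y)
  refine eq_fold (fold_mem _) (-k) ?_
  push_cast
  rcases hk with hk | hk
  · right; linarith
  · left; linarith

theorem fold_add_two_mul_int (y : ℝ) (m : ℤ) : fold (y + 2 * m) = fold y := by
  obtain ⟨k, hk⟩ := fold_spec (y + 2 * m)
  refine eq_fold (fold_mem _) (k - m) ?_
  push_cast
  rcases hk with hk | hk
  · left; linarith
  · right; linarith

theorem sub_or_add_eq_of_fold_eq {x y : ℝ} (h : fold x = fold y) :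
    ∃ k : ℤ, x - y = 2 * k ∨ x + y = 2 * k := by
  obtain ⟨i, hi⟩ := fold_spec x
  obtain ⟨j, hj⟩ := fold_spec y
  rcases hi with hi | hi <;> rcases hj with hj | hj
  · exact ⟨i - j, Or.inl (by push_cast; linarith)⟩
  · exact ⟨i + j, Or.inr (by push_cast; linarith)⟩
  · exact ⟨i + j, Or.inr (by push_cast; linarith)⟩
  · exact ⟨i - j, Or.inl (by push_cast; linarith)⟩

theorem tent_mem {z : ℝ} (hz : z ∈ Icc (0 : ℝ) 1) : tent z ∈ Icc (0 : ℝ) 1 := by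
  obtain ⟨h0, h1⟩ := hz
  unfold tent
  constructor
  · have : |1 - 2 * z| ≤ 1 := abs_le.2 ⟨by linarith, by linarith⟩
    linarith
  · linarith [abs_nonneg (1 - 2 * z)]

theorem tent_eq_fold {z : ℝ} (hz : z ∈ Icc (0 : ℝ) 1) : tent z = fold (2 * z) := by
  rcases abs_choice (1 - 2 * z) with h | h
  · exact eq_fold (tent_mem hz) 0 (Or.inl (by rw [tent, h]; push_cast; ring))
  · exact eq_fold (tent_mem hz) 1 (Or.inr (by rw [tent, h]; push_cast; ring))

theorem fold_nat_mul_fold (n : ℕ) (y : ℝ) : fold (n * fold y) = fold (n * y) := by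
  obtain ⟨k, hk⟩ := fold_spec y
  rcases hk with hk | hk
  · rw [hk, ← fold_add_two_mul_int (n * y) (-(n * k))]
    congr 1; push_cast; ring
  · rw [hk, ← fold_neg (n * y), ← fold_add_two_mul_int (-(n * y)) (n * k)]
    congr 1; push_cast; ring

theorem abs_fold_sub_fold_quarter (a : ℝ) :
    |fold a - fold (a + 1 / 4)| = 1 / 4 ∨
      |fold (a + 1 / 2) - fold (a + 1 / 4)| = 1 / 4 := by
  obtain ⟨k, hk⟩ := fold_spec (a + 1 / 4)
  obtain ⟨h0, h1⟩ := fold_mem (a + 1 / 4)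
  set c := fold (a + 1 / 4)
  rcases le_total c (1 / 2) with hc | hc
  · have hm : c + 1 / 4 ∈ Icc (0 : ℝ) 1 := ⟨by linarith, by linarith⟩
    rcases hk with hk | hk
    · right
      rw [← eq_fold (y := a + 1 / 2) hm k (Or.inl (by linarith))]
      norm_num
    · left
      rw [← eq_fold (y := a) hm k (Or.inr (by linarith))]
      norm_num
  · have hm : c - 1 / 4 ∈ Icc (0 : ℝ) 1 := ⟨by linarith, by linarith⟩
    rcases hk with hk | hk
    · left
      rw [← eq_fold (y := a) hm k (Or.inl (by linarith))]
      norm_num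
    · right
      rw [← eq_fold (y := a + 1 / 2) hm k (Or.inr (by linarith))]
      norm_num

section FoldEquivariant

variable {Φ : ℝ → ℝ}

theorem map_two_pow_mul (hm : ∀ y, Φ y ∈ Icc (0 : ℝ) 1)
    (h2 : ∀ y, Φ (2 * y) = fold (2 * Φ y)) (n : ℕ) (y : ℝ) :
    Φ (2 ^ n * y) = fold (2 ^ n * Φ y) := by
  induction n with
  | zero => simp [fold_of_mem (hm y)]
  | succ n ih =>
    rw [pow_succ', mul_assoc, h2, ih, mul_assoc]
    exact_mod_cast fold_nat_mul_fold 2 (2 ^ n * Φ y)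

/-- A modulus of continuity at one scale propagates to all finer scales. -/
theorem abs_sub_lt_of_scale (hc : Continuous Φ) (hm : ∀ y, Φ y ∈ Icc (0 : ℝ) 1)
    (h2 : ∀ y, Φ (2 * y) = fold (2 * Φ y)) {δ : ℝ}
    (hδ : ∀ x y, |x - y| ≤ δ → |Φ x - Φ y| < 1 / 4) (n : ℕ) {x y : ℝ}
    (hxy : 2 ^ n * |x - y| ≤ δ) : 2 ^ n * |Φ x - Φ y| < 1 / 2 := by
  wlog hle : Φ x ≤ Φ y generalizing x y
  · rw [abs_sub_comm]
    exact this (by rwa [abs_sub_comm]) (le_of_not_ge hle)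
  by_contra! hlt
  have hn : (0 : ℝ) < 2 ^ n := by positivity
  rw [abs_sub_comm, abs_of_nonneg (sub_nonneg.2 hle)] at hlt
  have hsub : Icc (Φ x) (Φ y) ⊆ Φ '' uIcc x y := by
    rw [← uIcc_of_le hle]
    exact intermediate_value_uIcc hc.continuousOn
  have hex : ∀ s ∈ Icc (0 : ℝ) (1 / 2), ∃ u ∈ uIcc x y, Φ (2 ^ n * u) = fold (2 ^ n * Φ x + s) := by
    rintro s ⟨hs0, hs1⟩
    have hle' : s / 2 ^ n ≤ Φ y - Φ x := by
      rw [div_le_iff₀ hn]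
      linarith
    obtain ⟨u, hu, hu'⟩ := hsub (show Φ x + s / 2 ^ n ∈ Icc (Φ x) (Φ y) from
      ⟨by linarith [div_nonneg hs0 hn.le], by linarith⟩)
    refine ⟨u, hu, ?_⟩
    rw [map_two_pow_mul hm h2, hu', mul_add, mul_div_cancel₀ _ hn.ne']
  have hclose : ∀ u ∈ uIcc x y, ∀ v ∈ uIcc x y, |Φ (2 ^ n * u) - Φ (2 ^ n * v)| < 1 / 4 := by
    intro u hu v hv
    apply hδ
    rw [← mul_sub, abs_mul, abs_of_pos hn]
    refine le_trans (mul_le_mul_of_nonneg_left ?_ hn.le) hxy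
    rw [abs_sub_comm x y]
    exact abs_sub_le_of_uIcc_subset_uIcc (uIcc_subset_uIcc hv hu)
  obtain ⟨u, hu, hu'⟩ := hex 0 (by norm_num)
  obtain ⟨v, hv, hv'⟩ := hex (1 / 4) (by norm_num)
  obtain ⟨w, hw, hw'⟩ := hex (1 / 2) (by norm_num)
  have h1 := hclose u hu v hv
  have h3 := hclose w hw v hv
  rw [hu', hv', add_zero] at h1
  rw [hw', hv'] at h3
  rcases abs_fold_sub_fold_quarter (2 ^ n * Φ x) with h | h <;> linarith

theorem exists_int_eq_six_mul (hm : ∀ y, Φ y ∈ Icc (0 : ℝ) 1)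
    (h2 : ∀ y, Φ (2 * y) = fold (2 * Φ y)) (hp : ∀ k : ℤ, Φ (2 * k) = Φ 0) (n : ℕ) (k : ℤ) :
    ∃ q : ℤ, 6 * 2 ^ n * Φ (k / 2 ^ n) = q := by
  have h0 : ∃ p : ℤ, 3 * Φ 0 = p := by
    have h := h2 0
    rw [mul_zero] at h
    obtain ⟨j, hj⟩ := fold_spec (2 * Φ 0)
    rcases hj with hj | hj
    · exact ⟨6 * j, by push_cast; linarith⟩
    · exact ⟨2 * j, by push_cast; linarith⟩
  obtain ⟨p, hp0⟩ := h0
  have h := map_two_pow_mul hm h2 (n + 1) (k / 2 ^ n)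
  rw [show (2 : ℝ) ^ (n + 1) * (k / 2 ^ n) = 2 * k by field_simp; ring, hp] at h
  obtain ⟨j, hj⟩ := fold_spec (2 ^ (n + 1) * Φ (k / 2 ^ n))
  rw [← h, pow_succ] at hj
  rcases hj with hj | hj
  · exact ⟨p + 6 * j, by push_cast; linarith⟩
  · exact ⟨6 * j - p, by push_cast; linarith⟩

theorem abs_sub_le_of_dyadic (hc : Continuous Φ) {C : ℝ}
    (hC : ∀ (n : ℕ) (k : ℤ), 2 ^ n * |Φ ((k + 1) / 2 ^ n) - Φ (k / 2 ^ n)| ≤ C) (x y : ℝ) :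
    |Φ x - Φ y| ≤ C * |x - y| := by
  have hgrid : ∀ (n : ℕ) (k : ℤ) (j : ℕ),
      |Φ ((k + j) / 2 ^ n) - Φ (k / 2 ^ n)| ≤ C * (j / 2 ^ n) := by
    intro n k j
    have hn : (0 : ℝ) < 2 ^ n := by positivity
    induction j with
    | zero => simp
    | succ j ih =>
      have h := hC n (k + j)
      rw [← le_div_iff₀' hn] at h
      push_cast at h ⊢
      rw [← add_assoc]
      calc _ ≤ _ + _ := abs_sub_le _ (Φ ((k + j) / 2 ^ n)) _
        _ ≤ C / 2 ^ n + C * (j / 2 ^ n) := add_le_add h ih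
        _ = _ := by ring
  have hgrid' : ∀ (n : ℕ) (i k : ℤ),
      |Φ (i / 2 ^ n) - Φ (k / 2 ^ n)| ≤ C * |(i : ℝ) / 2 ^ n - k / 2 ^ n| := by
    intro n i k
    wlog hki : k ≤ i generalizing i k
    · rw [abs_sub_comm, abs_sub_comm ((i : ℝ) / 2 ^ n)]
      exact this k i (le_of_not_ge hki)
    obtain ⟨j, rfl⟩ := Int.le.dest hki
    have h := hgrid n k j
    push_cast
    rwa [← sub_div, add_sub_cancel_left, abs_of_nonneg (show (0 : ℝ) ≤ (j : ℝ) / 2 ^ n by positivity)]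
  have hlim : ∀ z : ℝ, Filter.Tendsto (fun n : ℕ => (⌊z * 2 ^ n⌋ : ℝ) / 2 ^ n) Filter.atTop
      (nhds z) := by
    intro z
    have h0 : Filter.Tendsto (fun n : ℕ => z - (1 / 2 : ℝ) ^ n) Filter.atTop (nhds z) := by
      simpa using (tendsto_pow_atTop_nhds_zero_of_lt_one (by norm_num)
        (by norm_num : (1 / 2 : ℝ) < 1)).const_sub z
    refine tendsto_of_tendsto_of_tendsto_of_le_of_le h0 tendsto_const_nhds (fun n => ?_) fun n => ?_
    · have hn : (0 : ℝ) < 2 ^ n := by positivity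
      simp only
      rw [le_div_iff₀ hn, sub_mul, ← mul_pow]
      norm_num
      linarith [Int.lt_floor_add_one (z * 2 ^ n)]
    · exact (div_le_iff₀ (by positivity)).2 (Int.floor_le _)
  exact le_of_tendsto_of_tendsto'
    (((hc.tendsto x).comp (hlim x)).sub ((hc.tendsto y).comp (hlim y))).abs
    (((hlim x).sub (hlim y)).abs.const_mul C) fun n => hgrid' n _ _

/-- The slopes along dyadic grids are bounded multiples of `1/6`, hence some grid interval realises
the best Lipschitz constant. -/
theorem exists_maximal_slope (hu : UniformContinuous Φ) (hm : ∀ y, Φ y ∈ Icc (0 : ℝ) 1)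
    (h2 : ∀ y, Φ (2 * y) = fold (2 * Φ y)) (hp : ∀ k : ℤ, Φ (2 * k) = Φ 0) :
    ∃ (C : ℝ) (n : ℕ) (k : ℤ), (∀ x y, |Φ x - Φ y| ≤ C * |x - y|) ∧
      2 ^ n * |Φ ((k + 1) / 2 ^ n) - Φ (k / 2 ^ n)| = C := by
  let s : ℕ → ℤ → ℝ := fun n k => 2 ^ n * |Φ ((k + 1) / 2 ^ n) - Φ (k / 2 ^ n)|
  have hint : ∀ n k, ∃ q : ℕ, 6 * s n k = q := by
    intro n k
    obtain ⟨a, ha⟩ := exists_int_eq_six_mul hm h2 hp n (k + 1)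
    obtain ⟨b, hb⟩ := exists_int_eq_six_mul hm h2 hp n k
    refine ⟨(a - b).natAbs, ?_⟩
    rw [Nat.cast_natAbs, Int.cast_abs, Int.cast_sub, ← ha, ← hb, ← mul_sub, abs_mul,
      abs_of_pos (by positivity : (0 : ℝ) < 6 * 2 ^ n)]
    push_cast
    ring
  choose q hq using hint
  obtain ⟨ε, hε, hδ⟩ := Metric.uniformContinuous_iff.1 hu (1 / 4) (by norm_num)
  obtain ⟨d, hd⟩ := exists_pow_lt_of_lt_one hε (by norm_num : (1 / 2 : ℝ) < 1)
  have hδ' : ∀ x y, |x - y| ≤ (1 / 2 : ℝ) ^ d → |Φ x - Φ y| < 1 / 4 := fun x y hxy =>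
    hδ (lt_of_le_of_lt hxy hd)
  have hbound : ∀ n k, s n k ≤ 2 ^ d := by
    intro n k
    rcases le_total n d with hnd | hnd
    · have h1 : |Φ ((k + 1) / 2 ^ n) - Φ (k / 2 ^ n)| ≤ 1 :=
        abs_sub_le_iff.2 ⟨by linarith [(hm ((k + 1) / 2 ^ n)).2, (hm (k / 2 ^ n)).1],
          by linarith [(hm ((k + 1) / 2 ^ n)).1, (hm (k / 2 ^ n)).2]⟩
      calc s n k ≤ 2 ^ n * 1 := mul_le_mul_of_nonneg_left h1 (by positivity)
        _ ≤ 2 ^ d := by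
          rw [mul_one]
          exact pow_le_pow_right₀ one_le_two hnd
    · obtain ⟨m, rfl⟩ := Nat.exists_eq_add_of_le hnd
      have h := abs_sub_lt_of_scale hu.continuous hm h2 hδ' m
        (x := (k + 1) / 2 ^ (d + m)) (y := k / 2 ^ (d + m)) (le_of_eq (by
          rw [← sub_div, add_sub_cancel_left, abs_of_pos (by positivity), pow_add, one_div_pow]
          field_simp))
      calc s (d + m) k
          = 2 ^ d * (2 ^ m * |Φ ((k + 1) / 2 ^ (d + m)) - Φ (k / 2 ^ (d + m))|) := by
            simp only [s]; rw [pow_add, mul_assoc]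
        _ ≤ 2 ^ d * 1 := mul_le_mul_of_nonneg_left (by linarith) (by positivity)
        _ = 2 ^ d := mul_one _
  have hbdd : BddAbove (range fun p : ℕ × ℤ => q p.1 p.2) := by
    refine ⟨6 * 2 ^ d, ?_⟩
    rintro _ ⟨⟨n, k⟩, rfl⟩
    have h := hbound n k
    have : (q n k : ℝ) ≤ 6 * 2 ^ d := by rw [← hq]; linarith
    exact_mod_cast this
  obtain ⟨⟨n, k⟩, hnk⟩ := Nat.sSup_mem (range_nonempty _) hbdd
  refine ⟨s n k, n, k, abs_sub_le_of_dyadic hu.continuous fun n' k' => ?_, rfl⟩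
  have h1 : q n' k' ≤ q n k := by
    simp only at hnk
    rw [hnk]
    exact le_csSup hbdd ⟨(n', k'), rfl⟩
  have h3 : (q n' k' : ℝ) ≤ q n k := by exact_mod_cast h1
  rw [← hq, ← hq] at h3
  exact le_of_mul_le_mul_left h3 (by norm_num)

/-- A nonconstant map commuting with doubling modulo the triangle wave is a multiplication. -/
theorem exists_nat_eq_fold_mul (hu : UniformContinuous Φ) (hm : ∀ y, Φ y ∈ Icc (0 : ℝ) 1)
    (h2 : ∀ y, Φ (2 * y) = fold (2 * Φ y)) (hp : ∀ (y : ℝ) (k : ℤ), Φ (y + 2 * k) = Φ y)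
    (hne : ∃ x y, Φ x ≠ Φ y) :
    ∃ t : ℕ, 1 ≤ t ∧ ∀ y ∈ Icc (0 : ℝ) 1, Φ y = fold (t * y) := by
  obtain ⟨C, n, k, hlip, hmax⟩ :=
    exists_maximal_slope hu hm h2 fun k => by simpa using hp 0 k
  have hn : (0 : ℝ) < 2 ^ n := by positivity
  have hC : 0 < C := by
    obtain ⟨x, y, hxy⟩ := hne
    by_contra! hC
    have h := hlip x y
    have := mul_nonpos_of_nonpos_of_nonneg hC (abs_nonneg (x - y))
    exact hxy (sub_eq_zero.1 (abs_nonpos_iff.1 (h.trans this)))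
  obtain ⟨σ, hσ, hlin⟩ : ∃ σ : ℝ, (σ = 1 ∨ σ = -1) ∧ ∀ r ∈ Icc (0 : ℝ) 1,
      2 ^ n * Φ ((k + r) / 2 ^ n) = 2 ^ n * Φ (k / 2 ^ n) + σ * (C * r) := by
    have hl : ∀ r ∈ Icc (0 : ℝ) 1,
        |2 ^ n * Φ ((k + r) / 2 ^ n) - 2 ^ n * Φ (k / 2 ^ n)| ≤ C * r ∧
        |2 ^ n * Φ ((k + 1) / 2 ^ n) - 2 ^ n * Φ ((k + r) / 2 ^ n)| ≤ C * (1 - r) := by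
      rintro r ⟨hr0, hr1⟩
      have key : ∀ u v : ℝ, v ≤ u →
          |2 ^ n * Φ (u / 2 ^ n) - 2 ^ n * Φ (v / 2 ^ n)| ≤ C * (u - v) := by
        intro u v huv
        have h := mul_le_mul_of_nonneg_left (hlip (u / 2 ^ n) (v / 2 ^ n)) hn.le
        rw [← sub_div, abs_of_nonneg (div_nonneg (sub_nonneg.2 huv) hn.le)] at h
        rw [← mul_sub, abs_mul, abs_of_pos hn]
        refine h.trans (le_of_eq ?_)
        field_simp
      constructor
      · simpa using key (k + r) k (by linarith)
      · simpa using key (k + 1) (k + r) (by linarith)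
    rw [← abs_of_pos hn, ← abs_mul, mul_sub, abs_of_pos hn] at hmax
    rcases abs_choice (2 ^ n * Φ ((k + 1) / 2 ^ n) - 2 ^ n * Φ (k / 2 ^ n)) with h | h
    · refine ⟨1, Or.inl rfl, fun r hr => ?_⟩
      obtain ⟨ha, hb⟩ := hl r hr
      rw [abs_le] at ha hb
      linarith [ha.1, ha.2, hb.1, hb.2]
    · refine ⟨-1, Or.inr rfl, fun r hr => ?_⟩
      obtain ⟨ha, hb⟩ := hl r hr
      rw [abs_le] at ha hb
      linarith [ha.1, ha.2, hb.1, hb.2]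
  obtain ⟨β, hβ⟩ : ∃ β : ℝ, ∀ y ∈ Icc (0 : ℝ) 2, Φ y = fold (C * y + β) := by
    have h : ∀ y ∈ Icc (0 : ℝ) 2,
        Φ y = fold (σ * (C * y) + 2 * (2 ^ n * Φ (k / 2 ^ n))) := by
      rintro y ⟨hy0, hy1⟩
      have hr := hlin (y / 2) ⟨by linarith, by linarith⟩
      rw [← hp y k, show y + 2 * (k : ℝ) = 2 ^ (n + 1) * ((k + y / 2) / 2 ^ n) by
        field_simp; ring, map_two_pow_mul hm h2, pow_succ', mul_assoc, hr]
      congr 1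
      ring
    rcases hσ with rfl | rfl
    · exact ⟨_, fun y hy => by rw [h y hy, one_mul]⟩
    · refine ⟨-(2 * (2 ^ n * Φ (k / 2 ^ n))), fun y hy => ?_⟩
      rw [h y hy, ← fold_neg]
      congr 1
      ring
  have hβ2 : ∀ y ∈ Icc (0 : ℝ) 1, ∃ j : ℤ, β = 2 * j ∨ 4 * C * y + 3 * β = 2 * j := by
    rintro y ⟨hy0, hy1⟩
    have h := h2 y
    rw [hβ y ⟨hy0, by linarith⟩, hβ (2 * y) ⟨by linarith, by linarith⟩] at h
    have hf := fold_nat_mul_fold 2 (C * y + β)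
    push_cast at hf
    rw [hf] at h
    obtain ⟨j, hj⟩ := sub_or_add_eq_of_fold_eq h
    rcases hj with hj | hj
    · exact ⟨-j, Or.inl (by push_cast; linarith)⟩
    · exact ⟨j, Or.inr (by linarith)⟩
  obtain ⟨j, hj⟩ : ∃ j : ℤ, β = 2 * j := by
    obtain ⟨i, hi⟩ := hβ2 0 (by norm_num)
    have hz : 1 / (4 * C + 1) ∈ Icc (0 : ℝ) 1 :=
      ⟨by positivity, by rw [div_le_one (by positivity)]; linarith⟩
    obtain ⟨l, hl⟩ := hβ2 _ hz
    rcases hi with hi | hi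
    · exact ⟨i, hi⟩
    rcases hl with hl | hl
    · exact ⟨l, hl⟩
    exfalso
    have hpos : 0 < 4 * C * (1 / (4 * C + 1)) := by positivity
    have hlt : 4 * C * (1 / (4 * C + 1)) < 1 := by
      rw [mul_one_div, div_lt_one (by positivity)]
      linarith
    have h1 : (0 : ℝ) < (l - i : ℤ) := by push_cast; linarith
    have h3 : ((l - i : ℤ) : ℝ) < 1 := by push_cast; linarith
    have h1' : 0 < l - i := by exact_mod_cast h1
    have h3' : l - i < 1 := by exact_mod_cast h3
    omega
  have hfold : ∀ y ∈ Icc (0 : ℝ) 2, Φ y = fold (C * y) := fun y hy => by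
    rw [hβ y hy, hj, fold_add_two_mul_int]
  obtain ⟨m, hCm⟩ : ∃ m : ℤ, C = m := by
    have h := hp 0 1
    rw [hfold 0 (by norm_num), hfold _ (by norm_num)] at h
    obtain ⟨m, hm'⟩ := sub_or_add_eq_of_fold_eq h
    push_cast at hm'
    exact ⟨m, by rcases hm' with h | h <;> linarith⟩
  have hmpos : 0 < m := by
    rw [hCm] at hC
    exact_mod_cast hC
  refine ⟨m.toNat, by omega, fun y hy => ?_⟩
  rw [hfold y ⟨hy.1, by linarith [hy.2]⟩, hCm]
  congr 2
  exact_mod_cast (Int.toNat_of_nonneg hmpos.le).symm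

end FoldEquivariant

/-- every self semi conjugation `ψ` of `g` is `h ∘ ξ_t ∘ h⁻¹` for some
`t ≥ 1`, equivalently `ψ ∘ h = h ∘ ξ_t`. -/
theorem self_semiconj_eq_conj_xi
    (g h ψ : ℝ → ℝ) (hg : IsUnimodal g)
    (hhc : ContinuousOn h (Icc 0 1)) (hhb : BijOn h (Icc 0 1) (Icc 0 1))
    (hconj : ∀ x ∈ Icc (0:ℝ) 1, h (tent x) = g (h x))
    (hψc : ContinuousOn ψ (Icc 0 1)) (hψm : MapsTo ψ (Icc 0 1) (Icc 0 1))
    (hψs : SurjOn ψ (Icc 0 1) (Icc 0 1))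
    (hcomm : ∀ x ∈ Icc (0:ℝ) 1, ψ (g x) = g (ψ x)) :
    ∃ t : ℕ, 1 ≤ t ∧ ∀ x ∈ Icc (0:ℝ) 1, ψ (h x) = h (xi t x) := by
  let e : Icc (0 : ℝ) 1 ≃ₜ Icc (0 : ℝ) 1 :=
    Continuous.homeoOfEquivCompactToT2 (f := hhb.equiv h) (hhc.mapsToRestrict hhb.mapsTo)
  have he : ∀ z, (e z : ℝ) = h z := fun _ => rfl
  let F : Icc (0 : ℝ) 1 → Icc (0 : ℝ) 1 := fun z => e.symm (hψm.restrict ψ _ _ (e z))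
  have hF : ∀ z, h (F z) = ψ (h z) := fun z => by
    rw [← he, e.apply_symm_apply]
    rfl
  have hFc : Continuous F :=
    e.symm.continuous.comp ((hψc.mapsToRestrict hψm).comp e.continuous)
  let Φ : ℝ → ℝ := fun y => F ⟨fold y, fold_mem y⟩
  have hΦh : ∀ y, h (Φ y) = ψ (h (fold y)) := fun y => hF _
  have hΦm : ∀ y, Φ y ∈ Icc (0 : ℝ) 1 := fun y => (F _).2
  have hu : UniformContinuous Φ :=
    uniformContinuous_subtype_val.comp
      ((CompactSpace.uniformContinuous_of_continuous hFc).comp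
        (lipschitzWith_fold.uniformContinuous.subtype_mk _))
  have h2 : ∀ y, Φ (2 * y) = fold (2 * Φ y) := by
    intro y
    rw [← tent_eq_fold (hΦm y)]
    apply hhb.injOn (hΦm _) (tent_mem (hΦm y))
    have hf := fold_nat_mul_fold 2 y
    push_cast at hf
    rw [hconj _ (hΦm y), hΦh, hΦh, ← hcomm _ (hhb.mapsTo (fold_mem y)),
      ← hconj _ (fold_mem y), tent_eq_fold (fold_mem y), hf]
  have hp : ∀ (y : ℝ) (k : ℤ), Φ (y + 2 * k) = Φ y := fun y k => by
    simp only [Φ, fold_add_two_mul_int]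
  have hne : ∃ x y, Φ x ≠ Φ y := by
    have hsurj : ∀ w ∈ Icc (0 : ℝ) 1, ∃ y, h (Φ y) = w := by
      intro w hw
      obtain ⟨b, hb, rfl⟩ := hψs hw
      obtain ⟨a, ha, rfl⟩ := hhb.surjOn hb
      exact ⟨a, by rw [hΦh, fold_of_mem ha]⟩
    obtain ⟨x, hx⟩ := hsurj 0 (by norm_num)
    obtain ⟨y, hy⟩ := hsurj 1 (by norm_num)
    refine ⟨x, y, fun hxy => ?_⟩
    rw [hxy, hy] at hx
    exact one_ne_zero hx
  obtain ⟨t, ht, hΦ⟩ := exists_nat_eq_fold_mul hu hΦm h2 hp hne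
  refine ⟨t, ht, fun x hx => ?_⟩
  rw [xi_eq_fold, ← hΦ x hx, hΦh, fold_of_mem hx]
end

section
/- A map ψ : [0,1] → [0,1] is a self semi conjugation of the tent map f (i.e., ψ is continuous, surjective and ψ ∘ f = f ∘ ψ) if and only if there exists an integer t ≥ 1 such that ψ = ξ_t, where ξ_t(x) = (1 − (−1)^{⌊tx⌋})/2 + (−1)^{⌊tx⌋}·{tx}. -/
open Set

open Filter Topology MeasureTheory

/-- The zigzag map: the distance from `y` to the nearest even integer. -/
noncomputable def zigzag (y : ℝ) : ℝ := ‖(y : AddCircle (2 : ℝ))‖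

theorem zigzag_add_two_mul_int (y : ℝ) (k : ℤ) : zigzag (y + 2 * k) = zigzag y := by
  have h : (((2 : ℝ) * k : ℝ) : AddCircle (2 : ℝ)) = 0 :=
    (AddCircle.coe_eq_zero_iff _).2 ⟨k, by rw [zsmul_eq_mul, mul_comm]⟩
  rw [zigzag, zigzag, AddCircle.coe_add, h, add_zero]

theorem zigzag_neg (y : ℝ) : zigzag (-y) = zigzag y := by
  rw [zigzag, zigzag, AddCircle.coe_neg, norm_neg]

theorem zigzag_of_abs_le {y : ℝ} (h : |y| ≤ 1) : zigzag y = |y| :=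
  (AddCircle.norm_coe_eq_abs_iff 2 two_ne_zero).2 (by simpa using h)

theorem zigzag_of_mem {y : ℝ} (h : y ∈ Icc (0 : ℝ) 1) : zigzag y = y := by
  rw [zigzag_of_abs_le (abs_le.2 ⟨by linarith [h.1], h.2⟩), abs_of_nonneg h.1]

theorem zigzag_zero : zigzag 0 = 0 := zigzag_of_mem ⟨le_rfl, zero_le_one⟩

theorem zigzag_mem (y : ℝ) : zigzag y ∈ Icc (0 : ℝ) 1 :=
  ⟨norm_nonneg _, by
    simpa [zigzag] using
      AddCircle.norm_le_half_period (x := (y : AddCircle (2 : ℝ))) 2 two_ne_zero⟩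

theorem zigzag_eq_zero {y : ℝ} (h : zigzag y = 0) : ∃ k : ℤ, y = 2 * k := by
  obtain ⟨k, hk⟩ := (AddCircle.coe_eq_zero_iff _).1 (norm_eq_zero.1 h)
  exact ⟨k, by rw [← hk, zsmul_eq_mul, mul_comm]⟩

theorem abs_zigzag_sub_le (x y : ℝ) : |zigzag x - zigzag y| ≤ |x - y| := by
  refine (abs_norm_sub_norm_le _ _).trans ?_
  rw [← AddCircle.coe_sub]
  exact QuotientAddGroup.norm_mk_le_norm

theorem continuous_zigzag : Continuous zigzag :=
  continuous_norm.comp (AddCircle.continuous_mk' 2)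

theorem exists_eq_add_two_mul_int (y : ℝ) : ∃ (k : ℤ) (r : ℝ), |r| ≤ 1 ∧ y = r + 2 * k := by
  refine ⟨round (y / 2), y - 2 * round (y / 2), ?_, by ring⟩
  have := abs_le.1 (abs_sub_round (y / 2))
  rw [abs_le]
  constructor <;> linarith

theorem zigzag_add_one (y : ℝ) : zigzag (y + 1) = 1 - zigzag y := by
  obtain ⟨k, r, hr, rfl⟩ := exists_eq_add_two_mul_int y
  rw [add_right_comm, zigzag_add_two_mul_int, zigzag_add_two_mul_int, zigzag_of_abs_le hr]
  have := abs_le.1 hr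
  rcases le_total 0 r with h | h
  · rw [← zigzag_add_two_mul_int (r + 1) (-1), ← zigzag_neg, abs_of_nonneg h]
    push_cast
    rw [zigzag_of_mem (by constructor <;> linarith)]
    ring
  · rw [abs_of_nonpos h, zigzag_of_mem (by constructor <;> linarith)]
    ring

theorem tent_zigzag (y : ℝ) : tent (zigzag y) = zigzag (2 * y) := by
  obtain ⟨k, r, hr, rfl⟩ := exists_eq_add_two_mul_int y
  have e : (2 : ℝ) * (r + 2 * k) = 2 * r + 2 * ((2 * k : ℤ) : ℝ) := by push_cast; ring
  rw [e, zigzag_add_two_mul_int, zigzag_add_two_mul_int, zigzag_of_abs_le hr, tent]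
  have key : ∀ s : ℝ, 0 ≤ s → s ≤ 1 → 1 - |1 - 2 * s| = zigzag (2 * s) := by
    intro s h0 h1
    rcases le_total s (1 / 2) with h | h
    · rw [zigzag_of_mem (by constructor <;> linarith), abs_of_nonneg (by linarith)]
      ring
    · rw [← zigzag_neg, ← zigzag_add_two_mul_int _ 1]
      push_cast
      rw [zigzag_of_mem (by constructor <;> linarith), abs_of_nonpos (by linarith)]
      ring
  rw [key _ (abs_nonneg r) hr]
  rcases abs_choice r with h | h <;> rw [h]
  rw [mul_neg, zigzag_neg]

theorem zigzag_two_mul {x : ℝ} (hx : x ∈ Icc (0 : ℝ) 1) : zigzag (2 * x) = tent x := by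
  rw [← tent_zigzag, zigzag_of_mem hx]

theorem tent_mem_s19 {x : ℝ} (hx : x ∈ Icc (0 : ℝ) 1) : tent x ∈ Icc (0 : ℝ) 1 :=
  zigzag_two_mul hx ▸ zigzag_mem _

theorem xi_eq_zigzag (t : ℕ) (x : ℝ) : xi t x = zigzag (t * x) := by
  rw [xi]
  generalize (t : ℝ) * x = y
  have h0 := Int.fract_nonneg y
  have h1 := Int.fract_lt_one y
  have hy := Int.floor_add_fract y
  rcases Int.even_or_odd' ⌊y⌋ with ⟨k, hk | hk⟩
  · have hz : zigzag y = Int.fract y := by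
      conv_lhs => rw [← hy, hk, add_comm]
      push_cast
      rw [zigzag_add_two_mul_int, zigzag_of_mem ⟨h0, h1.le⟩]
    rw [hz, Even.neg_one_zpow (by rw [hk]; exact even_two_mul k)]
    ring
  · have hz : zigzag y = 1 - Int.fract y := by
      have e : y = Int.fract y + 1 + 2 * (k : ℝ) := by
        rw [hk] at hy
        push_cast at hy
        linarith
      conv_lhs => rw [e]
      rw [zigzag_add_two_mul_int, zigzag_add_one, zigzag_of_mem ⟨h0, h1.le⟩]
    rw [hz, Odd.neg_one_zpow (by rw [hk]; exact odd_two_mul_add_one k)]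
    ring

/-- If the image of `zigzag ∘ F` over an interval never oscillates by `1`, then `F` oscillates by
at most `2` there. -/
theorem abs_sub_le_two_of_zigzag_lt {F : ℝ → ℝ} (hF : Continuous F) {x y : ℝ}
    (h : ∀ u ∈ uIcc x y, ∀ v ∈ uIcc x y, |zigzag (F u) - zigzag (F v)| < 1) :
    |F x - F y| ≤ 2 := by
  by_contra! hc
  have hI : uIcc (F x) (F y) ⊆ F '' uIcc x y := intermediate_value_uIcc hF.continuousOn
  have hmm : max (F x) (F y) - min (F x) (F y) = |F x - F y| := max_sub_min_eq_abs' _ _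
  set m : ℤ := ⌈min (F x) (F y)⌉
  have h1 : min (F x) (F y) ≤ m := Int.le_ceil _
  have h2 : (m : ℝ) < min (F x) (F y) + 1 := Int.ceil_lt_add_one _
  obtain ⟨u, hu, hu'⟩ := hI (show (m : ℝ) ∈ uIcc (F x) (F y) from ⟨h1, by
    show (m : ℝ) ≤ max (F x) (F y)
    linarith⟩)
  obtain ⟨v, hv, hv'⟩ := hI (show (m : ℝ) + 1 ∈ uIcc (F x) (F y) from ⟨by
    show min (F x) (F y) ≤ m + 1
    linarith, by
    show (m : ℝ) + 1 ≤ max (F x) (F y)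
    linarith⟩)
  have := h u hu v hv
  rw [hu', hv', zigzag_add_one] at this
  obtain ⟨k, hk | hk⟩ := Int.even_or_odd' m
  · have e : zigzag (m : ℝ) = 0 := by
      rw [hk, ← zigzag_zero, ← zigzag_add_two_mul_int 0 k]
      push_cast
      rw [zero_add]
    norm_num [e] at this
  · have e : zigzag (m : ℝ) = 1 := by
      rw [hk, ← zigzag_of_mem (right_mem_Icc.2 (zero_le_one' ℝ)), ← zigzag_add_two_mul_int 1 k]
      push_cast
      rw [add_comm]
    norm_num [e] at this

section Functional

variable {g : ℝ → ℝ}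

theorem apply_two_pow_mul (h2 : ∀ z, g (2 * z) = zigzag (2 * g z)) (hz : ∀ z, zigzag (g z) = g z)
    (n : ℕ) (z : ℝ) : g (2 ^ n * z) = zigzag (2 ^ n * g z) := by
  induction n with
  | zero => simp [hz]
  | succ n ih =>
    rw [pow_succ', mul_assoc, h2, ih, ← tent_zigzag, zigzag_of_mem (zigzag_mem _), tent_zigzag,
      mul_assoc]

theorem exists_lipschitzWith (hg : UniformContinuous g) (h01 : ∀ z, g z ∈ Icc (0 : ℝ) 1)
    (hpow : ∀ (n : ℕ) (z : ℝ), g (2 ^ n * z) = zigzag (2 ^ n * g z)) :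
    ∃ K, LipschitzWith K g := by
  obtain ⟨δ, hδ, hδg⟩ := Metric.uniformContinuous_iff.1 hg 1 one_pos
  have step : ∀ (n : ℕ) (x y : ℝ), 2 ^ n * |x - y| < δ → 2 ^ n * |g x - g y| ≤ 2 := by
    intro n x y hxy
    have hp : (0 : ℝ) < 2 ^ n := by positivity
    have := abs_sub_le_two_of_zigzag_lt (F := fun z => 2 ^ n * g z) (x := x) (y := y)
      (continuous_const.mul hg.continuous) (fun u hu v hv => by
        rw [← hpow, ← hpow, ← Real.dist_eq]
        apply hδg
        rw [Real.dist_eq, ← mul_sub, abs_mul, abs_of_pos hp]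
        refine lt_of_le_of_lt ?_ hxy
        have := abs_sub_le_of_uIcc_subset_uIcc (uIcc_subset_uIcc hu hv)
        rw [abs_sub_comm u v, abs_sub_comm x y]
        gcongr)
    rwa [← mul_sub, abs_mul, abs_of_pos hp] at this
  refine ⟨⟨8 / δ, by positivity⟩, LipschitzWith.of_dist_le_mul fun x y => ?_⟩
  rw [Real.dist_eq, Real.dist_eq]
  show |g x - g y| ≤ 8 / δ * |x - y|
  rw [div_mul_eq_mul_div, le_div_iff₀ hδ]
  rcases eq_or_ne x y with rfl | hne
  · simp
  have hpos : 0 < |x - y| := abs_pos.2 (sub_ne_zero.2 hne)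
  have h1 : |g x - g y| ≤ 1 := by
    rw [abs_le]
    constructor <;> linarith [(h01 x).1, (h01 x).2, (h01 y).1, (h01 y).2]
  rcases le_or_gt δ (2 * |x - y|) with hle | hlt
  · nlinarith [abs_nonneg (g x - g y)]
  · obtain ⟨n, hn1, hn2⟩ := exists_nat_pow_near (x := δ / (2 * |x - y|)) (y := (2 : ℝ))
      ((one_le_div (by positivity)).2 hlt.le) one_lt_two
    rw [le_div_iff₀ (by positivity)] at hn1
    rw [div_lt_iff₀ (by positivity)] at hn2
    have hp : (0 : ℝ) < 2 ^ n * |x - y| := by positivity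
    have h2 := step n x y (by linarith)
    rw [pow_succ] at hn2
    calc |g x - g y| * δ ≤ |g x - g y| * (2 ^ n * 2 * (2 * |x - y|)) := by gcongr
      _ = (2 ^ n * |g x - g y|) * (4 * |x - y|) := by ring
      _ ≤ 2 * (4 * |x - y|) := by gcongr
      _ ≤ _ := by linarith

/-- Zooming in at a point of differentiability shows that `g` is an affine map followed by
`zigzag`. -/
theorem exists_eq_zigzag_affine (hg : Continuous g)
    (hper : ∀ (z : ℝ) (k : ℤ), g (z + 2 * k) = g z)
    (hpow : ∀ (n : ℕ) (z : ℝ), g (2 ^ n * z) = zigzag (2 ^ n * g z))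
    {s x₀ : ℝ} (hs : HasDerivAt g s x₀) : ∃ b : ℝ, ∀ w, g w = zigzag (b + s * w) := by
  choose k u hu hku using fun n : ℕ => exists_eq_add_two_mul_int (2 ^ n * x₀)
  choose l v hv hlv using fun n : ℕ => exists_eq_add_two_mul_int (2 ^ n * g x₀)
  obtain ⟨⟨a, b⟩, -, φ, hφ, hlim⟩ := (isCompact_Icc.prod isCompact_Icc).tendsto_subseq
    (x := fun n => (u n, v n)) (fun n => ⟨abs_le.1 (hu n), abs_le.1 (hv n)⟩)
  have hua : Tendsto (fun n => u (φ n)) atTop (𝓝 a) := (continuous_fst.tendsto _).comp hlim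
  have hvb : Tendsto (fun n => v (φ n)) atTop (𝓝 b) := (continuous_snd.tendsto _).comp hlim
  have key : ∀ w, g (a + w) = zigzag (b + s * w) := by
    intro w
    have hd : Tendsto (fun n : ℕ => 2 ^ n * (g (x₀ + w / 2 ^ n) - g x₀)) atTop (𝓝 (s * w)) := by
      rcases eq_or_ne w 0 with rfl | hw
      · simp
      have h0 : Tendsto (fun n : ℕ => w / 2 ^ n) atTop (𝓝[≠] 0) := by
        rw [tendsto_nhdsWithin_iff]
        refine ⟨?_, Eventually.of_forall fun n => div_ne_zero hw (by positivity)⟩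
        have := (tendsto_pow_atTop_nhds_zero_of_lt_one (r := (1 / 2 : ℝ)) (by norm_num)
          (by norm_num)).const_mul w
        simpa [div_eq_mul_inv] using this
      refine ((hs.tendsto_slope_zero.comp h0).mul_const w).congr fun n => ?_
      simp only [Function.comp, smul_eq_mul]
      field_simp
    have e : ∀ n, g (u n + w) = zigzag (v n + 2 ^ n * (g (x₀ + w / 2 ^ n) - g x₀)) := by
      intro n
      rw [← hper _ (k n), ← zigzag_add_two_mul_int _ (l n)]
      have e1 : u n + w + 2 * k n = 2 ^ n * (x₀ + w / 2 ^ n) := by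
        rw [mul_add, hku n, mul_div_cancel₀ _ (by positivity)]
        ring
      have e2 : v n + 2 ^ n * (g (x₀ + w / 2 ^ n) - g x₀) + 2 * l n
          = 2 ^ n * g (x₀ + w / 2 ^ n) := by
        rw [mul_sub, hlv n]
        ring
      rw [e1, e2, hpow]
    refine tendsto_nhds_unique ((hg.tendsto _).comp (hua.add_const w)) ?_
    refine ((continuous_zigzag.tendsto _).comp
      (hvb.add (hd.comp hφ.tendsto_atTop))).congr fun n => ?_
    exact (e (φ n)).symm
  refine ⟨b - s * a, fun w => ?_⟩
  have := key (w - a)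
  rw [add_sub_cancel] at this
  rw [this]
  congr 1
  ring

end Functional

theorem LipschitzWith.exists_hasDerivAt_ne_zero {g : ℝ → ℝ} {K : NNReal} (hg : LipschitzWith K g)
    {x y : ℝ} (hxy : g x ≠ g y) : ∃ s x₀, s ≠ 0 ∧ HasDerivAt g s x₀ := by
  by_contra! hc
  have hac : AbsolutelyContinuousOnInterval g x y :=
    (hg.lipschitzOnWith (s := uIcc x y)).absolutelyContinuousOnInterval
  obtain ⟨C, hC⟩ := hac.const_of_ae_hasDerivAt_zero (by
    filter_upwards [hg.ae_differentiableAt_real] with z hz _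
    have h0 : deriv g z = 0 := by
      by_contra h
      exact hc _ _ h hz.hasDerivAt
    exact h0 ▸ hz.hasDerivAt)
  exact hxy ((hC _ left_mem_uIcc).trans (hC _ right_mem_uIcc).symm)

theorem exists_nat_eq_zigzag_mul {ψ : ℝ → ℝ} (hψm : MapsTo ψ (Icc 0 1) (Icc 0 1))
    (hc : ContinuousOn ψ (Icc 0 1)) (hne : ∃ x ∈ Icc (0 : ℝ) 1, ψ x ≠ ψ 0)
    (hcomm : ∀ x ∈ Icc (0 : ℝ) 1, ψ (tent x) = tent (ψ x)) :
    ∃ t : ℕ, 1 ≤ t ∧ ∀ x ∈ Icc (0 : ℝ) 1, ψ x = zigzag (t * x) := by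
  set g : ℝ → ℝ := fun z => ψ (zigzag z) with hgdef
  have h01 : ∀ z, g z ∈ Icc (0 : ℝ) 1 := fun z => hψm (zigzag_mem z)
  have hgu : UniformContinuous g := by
    have hu := Metric.uniformContinuousOn_iff.1
      (isCompact_Icc.uniformContinuousOn_of_continuous hc)
    refine Metric.uniformContinuous_iff.2 fun ε hε => ?_
    obtain ⟨δ, hδ, h⟩ := hu ε hε
    exact ⟨δ, hδ, fun a b hab => h _ (zigzag_mem a) _ (zigzag_mem b)
      ((abs_zigzag_sub_le a b).trans_lt hab)⟩
  have hpow : ∀ (n : ℕ) (z : ℝ), g (2 ^ n * z) = zigzag (2 ^ n * g z) :=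
    apply_two_pow_mul
      (fun z => by
        rw [zigzag_two_mul (h01 z)]
        simp only [hgdef]
        rw [← tent_zigzag, hcomm _ (zigzag_mem z)])
      (fun z => zigzag_of_mem (h01 z))
  have hgψ : ∀ x ∈ Icc (0 : ℝ) 1, g x = ψ x := fun x hx => by
    simp only [hgdef, zigzag_of_mem hx]
  have m0 : (0 : ℝ) ∈ Icc (0 : ℝ) 1 := left_mem_Icc.2 zero_le_one
  obtain ⟨x, hx, hx0⟩ := hne
  obtain ⟨K, hK⟩ := exists_lipschitzWith hgu h01 hpow
  obtain ⟨s, x₀, hs, hd⟩ := hK.exists_hasDerivAt_ne_zero (x := x) (y := 0)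
    (by rwa [hgψ x hx, hgψ 0 m0])
  have hper : ∀ (z : ℝ) (k : ℤ), g (z + 2 * k) = g z := fun z k => by
    simp only [hgdef, zigzag_add_two_mul_int]
  obtain ⟨b, hb⟩ := exists_eq_zigzag_affine hgu.continuous hper hpow hd
  have heven : ∀ z, g (-z) = g z := fun z => by simp only [hgdef, zigzag_neg]
  obtain ⟨i, hi⟩ : ∃ i : ℤ, b = i := by
    have h := heven (b / s)
    rw [hb, hb, mul_neg, mul_div_cancel₀ _ hs, add_neg_cancel, zigzag_zero] at h
    obtain ⟨i, hi⟩ := zigzag_eq_zero h.symm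
    exact ⟨i, by linarith⟩
  obtain ⟨j, hj⟩ : ∃ j : ℤ, b + s = j := by
    have h : g (1 - (b + s) / s) = g (1 + (b + s) / s) := by
      rw [← heven, ← hper _ 1]
      congr 1
      push_cast
      ring
    have e1 : b + s * (1 - (b + s) / s) = 0 := by
      field_simp
      ring
    have e2 : b + s * (1 + (b + s) / s) = 2 * (b + s) := by
      field_simp
      ring
    rw [hb, hb, e1, e2, zigzag_zero] at h
    obtain ⟨j, hj⟩ := zigzag_eq_zero h.symm
    exact ⟨j, by linarith⟩
  have hb0 : zigzag b = 0 := by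
    have h := hpow 1 0
    rw [mul_zero, hb, mul_zero, add_zero, pow_one, zigzag_two_mul (zigzag_mem b), tent_zigzag, hi,
      ← zero_add (2 * (i : ℝ)), zigzag_add_two_mul_int, zigzag_zero, ← hi] at h
    exact h
  obtain ⟨l, hl⟩ := zigzag_eq_zero hb0
  have hsj : s = ((j - i : ℤ) : ℝ) := by
    push_cast
    linarith
  refine ⟨(j - i).natAbs, ?_, fun z hz => ?_⟩
  · rw [Nat.one_le_iff_ne_zero, Int.natAbs_ne_zero]
    rintro h
    exact hs (by rw [hsj, h, Int.cast_zero])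
  · rw [← hgψ z hz, hb, hl, add_comm, zigzag_add_two_mul_int, Nat.cast_natAbs, Int.cast_abs, ← hsj]
    rcases abs_choice s with h | h <;> rw [h]
    rw [neg_mul, zigzag_neg]

/-- `ψ : [0,1] → [0,1]` is a self semi conjugation of the tent map
iff `ψ = ξ_t` for some `t ≥ 1`. -/
theorem self_semiconj_tent_iff_xi
    (ψ : ℝ → ℝ) (hψm : MapsTo ψ (Icc 0 1) (Icc 0 1)) :
    (ContinuousOn ψ (Icc 0 1) ∧ SurjOn ψ (Icc 0 1) (Icc 0 1) ∧
      ∀ x ∈ Icc (0:ℝ) 1, ψ (tent x) = tent (ψ x)) ↔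
    ∃ t : ℕ, 1 ≤ t ∧ ∀ x ∈ Icc (0:ℝ) 1, ψ x = xi t x := by
  simp only [xi_eq_zigzag]
  constructor
  · rintro ⟨hc, hsurj, hcomm⟩
    refine exists_nat_eq_zigzag_mul hψm hc ?_ hcomm
    obtain ⟨p, hp, hp0⟩ := hsurj (left_mem_Icc.2 zero_le_one)
    obtain ⟨q, hq, hq1⟩ := hsurj (right_mem_Icc.2 zero_le_one)
    by_contra! h
    linarith [h p hp, h q hq]
  · rintro ⟨t, ht, hψ⟩
    have ht' : (1 : ℝ) ≤ t := by exact_mod_cast ht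
    refine ⟨?_, fun y hy => ?_, fun x hx => ?_⟩
    · exact (continuous_zigzag.comp (continuous_const.mul continuous_id)).continuousOn.congr hψ
    · have hm : y / t ∈ Icc (0 : ℝ) 1 :=
        ⟨div_nonneg hy.1 (by linarith), (div_le_one (by linarith)).2 (hy.2.trans ht')⟩
      refine ⟨y / t, hm, ?_⟩
      rw [hψ _ hm, mul_div_cancel₀ _ (by positivity), zigzag_of_mem hy]
    · rw [hψ _ hx, hψ _ (tent_mem_s19 hx), tent_zigzag, tent]
      rcases abs_choice (1 - 2 * x) with h | h <;> rw [h]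
      · congr 1
        ring
      · rw [← zigzag_neg, ← zigzag_add_two_mul_int _ t]
        congr 1
        push_cast
        ring
end
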